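/- For every d ≥ 3 there exists a strongly Barański diagonal IFS Φ on [0,1]^d satisfying the coordinate ordering condition whose limit set Λ_Φ satisfies HD(Λ_Φ) > DynD(Φ), i.e. the Hausdorff dimension of the sponge is strictly greater than its dynamical dimension. -/

import Mathlib

open MeasureTheory Filter Set Metric
open scoped Classical Topology ENNReal NNReal

namespace SelfAffineSponge

/-- A diagonal IFS on `[0,1]^d`: for each coordinate `i ∈ D = Fin d` a finite alphabet
`A i` indexing affine maps `x ↦ slope i a * x + off i a` of `[0,1]`, together with a
set `E ⊆ ∏ i, A i` of allowed tuples of symbols. -/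
structure DiagIFS (d : ℕ) (A : Fin d → Type) [∀ i, Fintype (A i)] where
  slope : ∀ i : Fin d, A i → ℝ
  off : ∀ i : Fin d, A i → ℝ
  E : Finset (∀ i, A i)

variable {d : ℕ} {A : Fin d → Type} [∀ i, Fintype (A i)]

namespace DiagIFS

/-- the base similarity `φ_{i,a}` in coordinate `i` -/
def base (Φ : DiagIFS d A) (i : Fin d) (a : A i) (x : ℝ) : ℝ :=
  Φ.slope i a * x + Φ.off i a

/-- the data defines an honest diagonal IFS: `E` is nonempty and each base map is a
contracting similarity of `[0,1]` -/
def Valid (Φ : DiagIFS d A) : Prop :=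
  Φ.E.Nonempty ∧ (∀ i a, Φ.slope i a ≠ 0) ∧ (∀ i a, |Φ.slope i a| < 1) ∧
    ∀ i a, ∀ x ∈ Set.Icc (0:ℝ) 1, Φ.base i a x ∈ Set.Icc (0:ℝ) 1

/-- the alphabet `E` of the IFS, as a type -/
abbrev Symb (Φ : DiagIFS d A) : Type _ := {a : ∀ i, A i // a ∈ Φ.E}

instance (Φ : DiagIFS d A) : MeasurableSpace Φ.Symb := ⊤
instance (Φ : DiagIFS d A) : TopologicalSpace Φ.Symb := ⊥

/-- the affine contraction `φ_a` of `[0,1]^d` associated to a tuple of symbols -/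
def affMap (Φ : DiagIFS d A) (a : ∀ i, A i) (x : Fin d → ℝ) : Fin d → ℝ :=
  fun i => Φ.base i (a i) (x i)

/-- the coding map `π(ω) = lim_n φ_{ω_0}∘⋯∘φ_{ω_{n-1}}(0)`, written in closed form -/
noncomputable def coding (Φ : DiagIFS d A) (ω : ℕ → Φ.Symb) : Fin d → ℝ :=
  fun i => ∑' n : ℕ, (∏ k ∈ Finset.range n, Φ.slope i ((ω k).1 i)) * Φ.off i ((ω n).1 i)

/-- the limit set `Λ_Φ = π(E^ℕ)` (the self-affine sponge) -/
def limitSet (Φ : DiagIFS d A) : Set (Fin d → ℝ) :=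
  Set.range Φ.coding

theorem coding_mem (Φ : DiagIFS d A) (ω : ℕ → Φ.Symb) : Φ.coding ω ∈ Φ.limitSet :=
  ⟨ω, rfl⟩

/-- the `i`-th Lyapunov exponent `χ_i(p) = -∫ log|φ'_{a,i}| dp(a)` of a finite measure
`p` on `E` (given by its density) -/
noncomputable def chi (Φ : DiagIFS d A) (i : Fin d) (p : Φ.Symb → ℝ) : ℝ :=
  -∑ a : Φ.Symb, p a * Real.log |Φ.slope i (a.1 i)|

/-- the mass `p([a]_I)` of the cylinder `[a]_I = {b ∈ E : b_i = a_i ∀ i ∈ I}` -/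
noncomputable def cylMass (Φ : DiagIFS d A) (I : Finset (Fin d)) (p : Φ.Symb → ℝ)
    (a : Φ.Symb) : ℝ :=
  ∑ b : Φ.Symb, if ∀ i ∈ I, b.1 i = a.1 i then p b else 0

/-- the entropy `h(I; p) = -∫ log p([a]_I) dp(a)` -/
noncomputable def entropy (Φ : DiagIFS d A) (I : Finset (Fin d)) (p : Φ.Symb → ℝ) : ℝ :=
  -∑ a : Φ.Symb, p a * Real.log (Φ.cylMass I p a)

/-- the conditional entropy `h(I' | I; p) = h(I';p) - h(I;p)` -/
noncomputable def condEntropy (Φ : DiagIFS d A) (I I' : Finset (Fin d))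
    (p : Φ.Symb → ℝ) : ℝ :=
  Φ.entropy I' p - Φ.entropy I p

/-- a coordinate set `I ⊆ D` is good if the projected IFS `Φ_I` satisfies the open set
condition: the boxes `φ_{I,a}((0,1)^I)`, indexed by distinct projections of elements of
`E`, are pairwise disjoint (equivalently, some coordinate has disjoint intervals). -/
def GoodIdx (Φ : DiagIFS d A) (I : Finset (Fin d)) : Prop :=
  ∀ a ∈ Φ.E, ∀ b ∈ Φ.E, (∃ i ∈ I, a i ≠ b i) →
    ∃ i ∈ I, Disjoint (Φ.base i (a i) '' Set.Ioo (0:ℝ) 1)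
      (Φ.base i (b i) '' Set.Ioo (0:ℝ) 1)

/-- Barański condition: each base IFS satisfies the open set condition w.r.t. `(0,1)` -/
def Baranski (Φ : DiagIFS d A) : Prop :=
  ∀ i : Fin d, ∀ a b : A i, a ≠ b →
    Disjoint (Φ.base i a '' Set.Ioo (0:ℝ) 1) (Φ.base i b '' Set.Ioo (0:ℝ) 1)

/-- strong Barański condition: each base IFS satisfies the strong separation condition
w.r.t. `[0,1]` -/
def StronglyBaranski (Φ : DiagIFS d A) : Prop :=
  ∀ i : Fin d, ∀ a b : A i, a ≠ b →
    Disjoint (Φ.base i a '' Set.Icc (0:ℝ) 1) (Φ.base i b '' Set.Icc (0:ℝ) 1)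

/-- coordinate ordering condition: some permutation `σ` of the coordinates has
`|φ'_{a,σ(1)}| > ⋯ > |φ'_{a,σ(d)}|` for all `a ∈ E` -/
def CoordOrdering (Φ : DiagIFS d A) : Prop :=
  ∃ σ : Equiv.Perm (Fin d), ∀ a ∈ Φ.E, ∀ i j : Fin d, i < j →
    |Φ.slope (σ j) (a (σ j))| < |Φ.slope (σ i) (a (σ i))|

end DiagIFS

/-- a probability vector (probability measure on a finite set, via its density) -/
def IsProbVec {α : Type*} [Fintype α] (p : α → ℝ) : Prop :=
  (∀ a, 0 ≤ p a) ∧ ∑ a, p a = 1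

/-- a measure `p` on `E` is good if `I(p,x) = {i : χ_i(p) ≤ x}` is good for all `x > 0` -/
def DiagIFS.GoodVec (Φ : DiagIFS d A) (p : Φ.Symb → ℝ) : Prop :=
  ∀ x > 0, Φ.GoodIdx (Finset.univ.filter fun i => Φ.chi i p ≤ x)

/-- a cycle on `E`: a continuous exponentially `λ`-periodic map `(0,∞) → P`,
where `λ = 1` means constant -/
structure Cycle (Φ : DiagIFS d A) where
  lam : ℝ
  one_le_lam : 1 ≤ lam
  r : ℝ → Φ.Symb → ℝ
  prob : ∀ b > 0, IsProbVec (r b)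
  cont : ContinuousOn r (Set.Ioi 0)
  periodic : ∀ b > 0, r (lam * b) = r b
  const_of_lam_eq_one : lam = 1 → ∀ b > 0, ∀ b' > 0, r b = r b'

/-- the number `B_i`, determined by `B = ∫_0^{B_i} χ_i(r_b) db` (written via `sInf`;
for a cycle the function `x ↦ ∫_0^x χ_i(r_b) db` is continuous and strictly
increasing, so the infimum is the unique solution) -/
noncomputable def Bcoord (Φ : DiagIFS d A) (r : ℝ → Φ.Symb → ℝ) (B : ℝ) (i : Fin d) : ℝ :=
  sInf {x : ℝ | 0 ≤ x ∧ B ≤ ∫ b in Set.Ioc (0:ℝ) x, Φ.chi i (r b)}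

/-- `δ(r, B) = B⁻¹ ∫_0^∞ h({i : b ≤ B_i}; r_b) db` -/
noncomputable def deltaRB (Φ : DiagIFS d A) (r : ℝ → Φ.Symb → ℝ) (B : ℝ) : ℝ :=
  B⁻¹ * ∫ b in Set.Ioi (0:ℝ),
    Φ.entropy (Finset.univ.filter fun i => b ≤ Bcoord Φ r B i) (r b)

/-- `δ(r) = inf_{B ∈ [1,λ]} δ(r,B)` -/
noncomputable def Cycle.delta {Φ : DiagIFS d A} (c : Cycle Φ) : ℝ :=
  sInf (deltaRB Φ c.r '' Set.Icc 1 c.lam)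

/-- `δ(p) = ∫_0^∞ h({i : b ≤ 1/χ_i(p)}; p) db` -/
noncomputable def deltaP (Φ : DiagIFS d A) (p : Φ.Symb → ℝ) : ℝ :=
  ∫ b in Set.Ioi (0:ℝ),
    Φ.entropy (Finset.univ.filter fun i => b ≤ (Φ.chi i p)⁻¹) p

/-- the normalized average `R̂_B = B⁻¹ ∫_0^B r_b db` of a cycle -/
noncomputable def cycleAvg {Φ : DiagIFS d A} (c : Cycle Φ) (B : ℝ) : Φ.Symb → ℝ :=
  fun a => B⁻¹ * ∫ b in Set.Ioc (0:ℝ) B, c.r b a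

/-- a cycle is good if all its normalized averages `R̂_B` are good -/
def Cycle.Good {Φ : DiagIFS d A} (c : Cycle Φ) : Prop :=
  ∀ B > 0, Φ.GoodVec (cycleAvg c B)

/-- a cycle is nondegenerate if `{b > 0 : r_b(a) > 0 ∀ a ∈ E_r}` is dense in `(0,∞)` -/
def Cycle.Nondeg {Φ : DiagIFS d A} (c : Cycle Φ) : Prop :=
  Set.Ioi (0:ℝ) ⊆
    closure {b : ℝ | 0 < b ∧ ∀ a : Φ.Symb, (∃ b' > 0, 0 < c.r b' a) → 0 < c.r b a}

/-- the lower pointwise dimension `d̲(x,μ) = liminf_{ρ→0} log μ(B(x,ρ))/log ρ` -/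
noncomputable def lowerPtDim {X : Type*} [PseudoMetricSpace X] [MeasurableSpace X]
    (μ : Measure X) (x : X) : ℝ≥0∞ :=
  Filter.liminf
    (fun ρ : ℝ => ENNReal.ofReal (Real.log (μ (Metric.ball x ρ)).toReal / Real.log ρ))
    (𝓝[>] (0:ℝ))

/-- the Hausdorff dimension of a measure: the essential supremum of its lower
pointwise dimension -/
noncomputable def measDim {X : Type*} [PseudoMetricSpace X] [MeasurableSpace X]
    (μ : Measure X) : ℝ≥0∞ :=
  essSup (lowerPtDim μ) μ

/-- the shift map on `E^ℕ` -/
def shift {α : Type*} (ω : ℕ → α) : ℕ → α := fun n => ω (n + 1)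

/-- the dynamical dimension: the supremum of `HD(π_*μ)` over shift-invariant
probability measures `μ` on `E^ℕ` -/
noncomputable def DiagIFS.dynDim (Φ : DiagIFS d A) : ℝ≥0∞ :=
  sSup {x : ℝ≥0∞ | ∃ μ : Measure (ℕ → Φ.Symb), IsProbabilityMeasure μ ∧
    Measure.map shift μ = μ ∧ x = measDim (Measure.map Φ.coding μ)}

/-- `μ` is the product measure on `E^ℕ` whose `k`-th factor has density `p k`
(this property characterizes `μ` uniquely) -/
def IsProductMeasure (Φ : DiagIFS d A) (p : ℕ → Φ.Symb → ℝ)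
    (μ : Measure (ℕ → Φ.Symb)) : Prop :=
  IsProbabilityMeasure μ ∧
    ∀ (n : ℕ) (w : ℕ → Φ.Symb),
      (μ {ω | ∀ k < n, ω k = w k}).toReal = ∏ k ∈ Finset.range n, p k (w k)

/-- the set of Hausdorff dimensions of Bernoulli measures `ν_p = π_*[p^ℕ]` -/
noncomputable def bernoulliDims (Φ : DiagIFS d A) : Set ℝ≥0∞ :=
  {x | ∃ p : Φ.Symb → ℝ, IsProbVec p ∧ ∃ μ : Measure (ℕ → Φ.Symb),
    IsProductMeasure Φ (fun _ => p) μ ∧ x = measDim (Measure.map Φ.coding μ)}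

/-- the set of Hausdorff dimensions of pseudo-Bernoulli measures
`ν_r = π_*[∏_n r_n]` -/
noncomputable def pseudoBernoulliDims (Φ : DiagIFS d A) : Set ℝ≥0∞ :=
  {x | ∃ c : Cycle Φ, ∃ μ : Measure (ℕ → Φ.Symb),
    IsProductMeasure Φ (fun n => c.r ((n : ℝ) + 1)) μ ∧
      x = measDim (Measure.map Φ.coding μ)}

namespace DiagIFS

instance (Φ : DiagIFS d A) : DiscreteTopology Φ.Symb := ⟨rfl⟩

instance (Φ : DiagIFS d A) : DiscreteMeasurableSpace Φ.Symb := ⟨fun _ => trivial⟩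

/-- Quantitative contraction and separation: in every coordinate the maps contract `[0, 1]` into
itself by a positive factor at most `1 / 2`, and images of `[0, 1]` under different maps have
distance at least `g`. -/
structure Separated (Φ : DiagIFS d A) (g : ℝ) : Prop where
  gap_pos : 0 < g
  slope_pos : ∀ i a, 0 < Φ.slope i a
  slope_le : ∀ i a, Φ.slope i a ≤ 1 / 2
  base_mem : ∀ i a, ∀ x ∈ Set.Icc (0 : ℝ) 1, Φ.base i a x ∈ Set.Icc (0 : ℝ) 1
  gap_le : ∀ i a b, a ≠ b → ∀ x ∈ Set.Icc (0 : ℝ) 1, ∀ y ∈ Set.Icc (0 : ℝ) 1,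
    g ≤ |Φ.base i a x - Φ.base i b y|

namespace Separated

variable {Φ : DiagIFS d A} {g : ℝ}

theorem off_mem (hΦ : Φ.Separated g) (i : Fin d) (a : A i) : Φ.off i a ∈ Set.Icc (0 : ℝ) 1 := by
  simpa [base] using hΦ.base_mem i a 0 (by simp)

theorem prod_slope_pos (hΦ : Φ.Separated g) (ω : ℕ → Φ.Symb) (i : Fin d) (n : ℕ) :
    0 < ∏ k ∈ Finset.range n, Φ.slope i ((ω k).1 i) :=
  Finset.prod_pos fun _ _ => hΦ.slope_pos _ _

theorem prod_slope_le (hΦ : Φ.Separated g) (ω : ℕ → Φ.Symb) (i : Fin d) (n : ℕ) :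
    ∏ k ∈ Finset.range n, Φ.slope i ((ω k).1 i) ≤ (1 / 2) ^ n := by
  simpa using Finset.prod_le_prod (s := Finset.range n)
    (fun k _ => (hΦ.slope_pos i ((ω k).1 i)).le) fun k _ => hΦ.slope_le i ((ω k).1 i)

theorem norm_term_le (hΦ : Φ.Separated g) (ω : ℕ → Φ.Symb) (i : Fin d) (n : ℕ) :
    ‖(∏ k ∈ Finset.range n, Φ.slope i ((ω k).1 i)) * Φ.off i ((ω n).1 i)‖ ≤ (1 / 2) ^ n := by
  have h := hΦ.off_mem i ((ω n).1 i)
  rw [Real.norm_of_nonneg (mul_nonneg (hΦ.prod_slope_pos ω i n).le h.1), ← mul_one ((1 / 2) ^ n)]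
  exact mul_le_mul (hΦ.prod_slope_le ω i n) h.2 h.1 (by positivity)

theorem summable_term (hΦ : Φ.Separated g) (ω : ℕ → Φ.Symb) (i : Fin d) :
    Summable fun n => (∏ k ∈ Finset.range n, Φ.slope i ((ω k).1 i)) * Φ.off i ((ω n).1 i) :=
  Summable.of_norm_bounded summable_geometric_two (hΦ.norm_term_le ω i)

theorem coding_eq (hΦ : Φ.Separated g) (ω : ℕ → Φ.Symb) (i : Fin d) :
    Φ.coding ω i = Φ.base i ((ω 0).1 i) (Φ.coding (shift ω) i) := by
  rw [coding, (hΦ.summable_term ω i).tsum_eq_zero_add, base, coding, ← tsum_mul_left, add_comm]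
  simp only [Finset.prod_range_succ', shift, Finset.range_zero, Finset.prod_empty, one_mul]
  congr 2
  funext n
  ring

theorem partialSum_mem (hΦ : Φ.Separated g) (i : Fin d) (m : ℕ) (ω : ℕ → Φ.Symb) :
    ∑ n ∈ Finset.range m, (∏ k ∈ Finset.range n, Φ.slope i ((ω k).1 i)) * Φ.off i ((ω n).1 i) ∈
      Set.Icc (0 : ℝ) 1 := by
  induction m generalizing ω with
  | zero => simp
  | succ m ih =>
    have h := hΦ.base_mem i ((ω 0).1 i) _ (ih (shift ω))
    convert h using 1
    rw [Finset.sum_range_succ', base, Finset.mul_sum]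
    simp only [Finset.prod_range_succ', shift, Finset.range_zero, Finset.prod_empty, one_mul]
    congr 2
    funext n
    ring

theorem coding_mem_Icc (hΦ : Φ.Separated g) (ω : ℕ → Φ.Symb) (i : Fin d) :
    Φ.coding ω i ∈ Set.Icc (0 : ℝ) 1 :=
  isClosed_Icc.mem_of_tendsto (hΦ.summable_term ω i).hasSum.tendsto_sum_nat
    (Eventually.of_forall fun m => hΦ.partialSum_mem i m ω)

theorem coding_sub_eq (hΦ : Φ.Separated g) (i : Fin d) (n : ℕ) (ω ω' : ℕ → Φ.Symb)
    (h : ∀ k < n, (ω' k).1 i = (ω k).1 i) :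
    Φ.coding ω i - Φ.coding ω' i = (∏ k ∈ Finset.range n, Φ.slope i ((ω k).1 i)) *
      (Φ.coding (fun k => ω (n + k)) i - Φ.coding (fun k => ω' (n + k)) i) := by
  induction n generalizing ω ω' with
  | zero => simp
  | succ n ih =>
    rw [hΦ.coding_eq ω, hΦ.coding_eq ω', h 0 n.succ_pos, base, base, add_sub_add_right_eq_sub,
      ← mul_sub, ih (shift ω) (shift ω') fun k hk => h (k + 1) (by omega),
      Finset.prod_range_succ']
    simp only [shift, add_right_comm n _ 1, add_assoc]
    ring

theorem abs_coding_sub_le (hΦ : Φ.Separated g) {i : Fin d} {n : ℕ} {ω ω' : ℕ → Φ.Symb}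
    (h : ∀ k < n, (ω' k).1 i = (ω k).1 i) :
    |Φ.coding ω i - Φ.coding ω' i| ≤ ∏ k ∈ Finset.range n, Φ.slope i ((ω k).1 i) := by
  rw [hΦ.coding_sub_eq i n ω ω' h, abs_mul, abs_of_pos (hΦ.prod_slope_pos ω i n)]
  refine mul_le_of_le_one_right (hΦ.prod_slope_pos ω i n).le ?_
  have h₁ := hΦ.coding_mem_Icc (fun k => ω (n + k)) i
  have h₂ := hΦ.coding_mem_Icc (fun k => ω' (n + k)) i
  exact abs_le.2 ⟨by linarith [h₁.1, h₂.2], by linarith [h₁.2, h₂.1]⟩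

theorem agree_of_abs_coding_sub_lt (hΦ : Φ.Separated g) {i : Fin d} {n : ℕ} {ω ω' : ℕ → Φ.Symb}
    (h : |Φ.coding ω i - Φ.coding ω' i| < g * ∏ k ∈ Finset.range n, Φ.slope i ((ω k).1 i)) :
    ∀ k < n, (ω' k).1 i = (ω k).1 i := by
  intro k
  induction k using Nat.strong_induction_on with
  | _ k ih =>
    intro hk
    by_contra hne
    have h₁ := hΦ.coding_sub_eq i k ω ω' fun l hl => ih l hl (hl.trans hk)
    rw [hΦ.coding_eq (fun l => ω (k + l)), hΦ.coding_eq (fun l => ω' (k + l))] at h₁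
    rw [h₁, abs_mul, abs_of_pos (hΦ.prod_slope_pos ω i k)] at h
    have h₂ := hΦ.gap_le i ((ω k).1 i) ((ω' k).1 i) (Ne.symm hne)
      _ (hΦ.coding_mem_Icc (shift fun l => ω (k + l)) i)
      _ (hΦ.coding_mem_Icc (shift fun l => ω' (k + l)) i)
    have h₃ : ∏ l ∈ Finset.range n, Φ.slope i ((ω l).1 i) ≤
        ∏ l ∈ Finset.range k, Φ.slope i ((ω l).1 i) :=
      antitone_nat_of_succ_le (f := fun n => ∏ l ∈ Finset.range n, Φ.slope i ((ω l).1 i))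
        (fun m => by
          rw [Finset.prod_range_succ]
          exact mul_le_of_le_one_right (hΦ.prod_slope_pos ω i m).le
            ((hΦ.slope_le _ _).trans (by norm_num))) hk.le
    have h₄ := mul_le_mul h₃ h₂ hΦ.gap_pos.le (hΦ.prod_slope_pos ω i k).le
    simp only [add_zero] at h
    linarith

theorem coding_injective (hΦ : Φ.Separated g) : Function.Injective Φ.coding := by
  intro ω ω' h
  funext k
  refine Subtype.ext (funext fun i => ?_)
  refine (hΦ.agree_of_abs_coding_sub_lt (n := k + 1) ?_ k k.lt_succ_self).symm
  rw [h, sub_self, abs_zero]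
  exact mul_pos hΦ.gap_pos (hΦ.prod_slope_pos ω i _)

theorem continuous_coding (hΦ : Φ.Separated g) : Continuous Φ.coding := by
  refine continuous_pi fun i => continuous_tsum (fun n => ?_) summable_geometric_two
    fun n ω => hΦ.norm_term_le ω i n
  have h (f : Φ.Symb → ℝ) (k : ℕ) : Continuous fun ω : ℕ → Φ.Symb => f (ω k) :=
    continuous_of_discreteTopology.comp (continuous_apply k)
  exact (continuous_finsetProd _ fun k _ => h (fun a => Φ.slope i (a.1 i)) k).mul
    (h (fun a => Φ.off i (a.1 i)) n)

theorem measurableEmbedding_coding (hΦ : Φ.Separated g) : MeasurableEmbedding Φ.coding :=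
  hΦ.continuous_coding.measurable.measurableEmbedding hΦ.coding_injective

end Separated

end DiagIFS

section Construction

/-- The number of symbols in one coordinate when the symbols with tag `j` number `N ^ h j`. -/
def alphabetSize (N : ℕ) (h : Fin 4 → ℕ) : ℕ := ∑ j, N ^ h j

/-- The tag of a symbol. -/
def tag {N : ℕ} {h : Fin 4 → ℕ} (a : Fin (alphabetSize N h)) : Fin 4 :=
  (finSigmaFinEquiv.symm a).1

variable {N : ℕ} {χ h : Fin d → Fin 4 → ℕ}

/-- The sponge in which a symbol with tag `j` contracts coordinate `i` by `N ^ (-χ i j)`, the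
alphabet of coordinate `i` has `N ^ h i j` symbols with tag `j`, and a tuple of symbols is allowed
when all its tags coincide. -/
noncomputable def sponge (N : ℕ) (χ h : Fin d → Fin 4 → ℕ) :
    DiagIFS d fun i => Fin (alphabetSize N (h i)) where
  slope i a := ((N : ℝ) ^ χ i (tag a))⁻¹
  off i a := (a : ℕ) / (alphabetSize N (h i) : ℝ)
  E := Finset.univ.filter fun a => ∃ j, ∀ i, tag (a i) = j

/-- The allowed tuple of symbols with given tag and given positions within that tag. -/
def mkSymb (N : ℕ) (χ h : Fin d → Fin 4 → ℕ) (j : Fin 4) (y : ∀ i, Fin (N ^ h i j)) :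
    (sponge N χ h).Symb :=
  ⟨fun i => finSigmaFinEquiv ⟨j, y i⟩,
    Finset.mem_filter.2 ⟨Finset.mem_univ _, j, fun i => by simp [tag]⟩⟩

theorem tag_mkSymb (j : Fin 4) (y : ∀ i, Fin (N ^ h i j)) (i : Fin d) :
    tag ((mkSymb N χ h j y).1 i) = j := by
  simp [mkSymb, tag]

/-- The common tag of an allowed tuple of symbols. -/
noncomputable def state [NeZero d] (a : (sponge N χ h).Symb) : Fin 4 := tag (a.1 0)

theorem tag_eq_state [NeZero d] (a : (sponge N χ h).Symb) (i : Fin d) : tag (a.1 i) = state a := by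
  obtain ⟨j, hj⟩ := (Finset.mem_filter.1 a.2).2
  rw [state, hj, hj]

theorem exists_mkSymb_eq [NeZero d] (a : (sponge N χ h).Symb) :
    ∃ y, mkSymb N χ h (state a) y = a := by
  have hy (i : Fin d) : ∃ y : Fin (N ^ h i (state a)), finSigmaFinEquiv ⟨state a, y⟩ = a.1 i := by
    rw [← tag_eq_state a i]
    exact ⟨(finSigmaFinEquiv.symm (a.1 i)).2, finSigmaFinEquiv.apply_symm_apply _⟩
  choose y hy using hy
  exact ⟨y, Subtype.ext (funext hy)⟩

theorem mkSymb_apply_eq_iff {j : Fin 4} {y z : ∀ i, Fin (N ^ h i j)} {i : Fin d} :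
    (mkSymb N χ h j y).1 i = (mkSymb N χ h j z).1 i ↔ y i = z i :=
  finSigmaFinEquiv.injective.eq_iff.trans (by simp)

theorem slope_eq [NeZero d] (a : (sponge N χ h).Symb) (i : Fin d) :
    (sponge N χ h).slope i (a.1 i) = ((N : ℝ) ^ χ i (state a))⁻¹ := by
  rw [← tag_eq_state a i]
  rfl

theorem prod_slope_eq [NeZero d] (ω : ℕ → (sponge N χ h).Symb) (i : Fin d) (n : ℕ) :
    ∏ k ∈ Finset.range n, (sponge N χ h).slope i ((ω k).1 i) =
      ((N : ℝ) ^ ∑ k ∈ Finset.range n, χ i (state (ω k)))⁻¹ := by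
  simp only [slope_eq, Finset.prod_inv_distrib, Finset.prod_pow_eq_pow_sum]

theorem alphabetSize_pos (hN : 0 < N) (h : Fin 4 → ℕ) : 0 < alphabetSize N h :=
  Finset.sum_pos (fun _ _ => by positivity) Finset.univ_nonempty

theorem slope_le_inv_alphabetSize (hN : 8 ≤ N) {i : Fin d} (hlt : ∀ j j', h i j < χ i j')
    (a : Fin (alphabetSize N (h i))) :
    (sponge N χ h).slope i a ≤ (2 * (alphabetSize N (h i) : ℝ))⁻¹ := by
  have hpos := alphabetSize_pos (by omega : 0 < N) (h i)
  refine inv_anti₀ (by positivity) ?_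
  have h₁ : alphabetSize N (h i) * 8 ≤ ∑ _j : Fin 4, N ^ χ i (tag a) := by
    rw [alphabetSize, Finset.sum_mul]
    refine Finset.sum_le_sum fun j _ => ?_
    calc N ^ h i j * 8 ≤ N ^ h i j * N := Nat.mul_le_mul_left _ hN
      _ = N ^ (h i j + 1) := (pow_succ _ _).symm
      _ ≤ N ^ χ i (tag a) := Nat.pow_le_pow_right (by omega) (hlt j _)
  have h₂ : 2 * alphabetSize N (h i) ≤ N ^ χ i (tag a) := by
    simp only [Finset.sum_const, Finset.card_univ, Fintype.card_fin, smul_eq_mul] at h₁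
    omega
  exact_mod_cast h₂

theorem sponge_separated (hN : 8 ≤ N) (hlt : ∀ i j j', h i j < χ i j') :
    (sponge N χ h).Separated (2 * ∑ i, (alphabetSize N (h i) : ℝ) + 1)⁻¹ := by
  have hN0 : (0 : ℝ) < N := by exact_mod_cast (by omega : 0 < N)
  have hpos (i : Fin d) : (1 : ℝ) ≤ alphabetSize N (h i) := by
    exact_mod_cast alphabetSize_pos (by omega : 0 < N) (h i)
  have hs (i : Fin d) (a) : 0 < (sponge N χ h).slope i a := inv_pos.2 (pow_pos hN0 _)
  have hs' (i : Fin d) (a) := slope_le_inv_alphabetSize hN (hlt i) a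
  have base_bounds (i : Fin d) (a : Fin (alphabetSize N (h i))) (x : ℝ)
      (hx : x ∈ Set.Icc (0 : ℝ) 1) :
      (a : ℝ) / alphabetSize N (h i) ≤ (sponge N χ h).base i a x ∧
        (sponge N χ h).base i a x ≤ (a + 1 / 2) / alphabetSize N (h i) := by
    have h₁ : (sponge N χ h).slope i a * x ≤ (2 * (alphabetSize N (h i) : ℝ))⁻¹ :=
      (mul_le_of_le_one_right (hs i a).le hx.2).trans (hs' i a)
    have h₂ := mul_nonneg (hs i a).le hx.1
    have h₃ : (sponge N χ h).off i a = (a : ℝ) / alphabetSize N (h i) := rfl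
    rw [DiagIFS.base, h₃, add_div, show (1 / 2 : ℝ) / alphabetSize N (h i) =
      (2 * (alphabetSize N (h i) : ℝ))⁻¹ by rw [div_div, one_div]]
    constructor <;> linarith
  refine ⟨by positivity, hs, fun i a => (hs' i a).trans ?_, ?_, ?_⟩
  · rw [one_div]
    exact inv_anti₀ two_pos (by linarith [hpos i])
  · intro i a x hx
    obtain ⟨h₁, h₂⟩ := base_bounds i a x hx
    refine ⟨le_trans (by positivity) h₁, h₂.trans ?_⟩
    rw [div_le_one (by linarith [hpos i])]
    have : ((a : ℕ) : ℝ) + 1 ≤ alphabetSize N (h i) := by exact_mod_cast a.2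
    linarith
  · intro i a b hab x hx y hy
    have hsum : (alphabetSize N (h i) : ℝ) ≤ ∑ i, (alphabetSize N (h i) : ℝ) :=
      Finset.single_le_sum (f := fun i => (alphabetSize N (h i) : ℝ))
        (fun _ _ => Nat.cast_nonneg _) (Finset.mem_univ i)
    have hg : (2 * ∑ i, (alphabetSize N (h i) : ℝ) + 1)⁻¹ ≤
        1 / 2 / (alphabetSize N (h i) : ℝ) := by
      rw [div_div, one_div]
      exact inv_anti₀ (by linarith [hpos i]) (by linarith)
    wlog hlt' : a < b generalizing a b x y
    · rw [abs_sub_comm]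
      exact this b a hab.symm y hy x hx (lt_of_le_of_ne (not_lt.1 hlt') hab.symm)
    obtain ⟨-, h₁⟩ := base_bounds i a x hx
    obtain ⟨h₂, -⟩ := base_bounds i b y hy
    have h₃ : (a : ℝ) + 1 ≤ b := by exact_mod_cast hlt'
    have h₄ : (a + 1 / 2 : ℝ) / alphabetSize N (h i) + 1 / 2 / alphabetSize N (h i) ≤
        (b : ℝ) / alphabetSize N (h i) := by
      rw [← add_div]
      exact div_le_div_of_nonneg_right (by linarith) (by linarith [hpos i])
    rw [abs_sub_comm]
    exact hg.trans (le_trans (by linarith) (le_abs_self _))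

theorem sponge_valid (hN : 8 ≤ N) (hlt : ∀ i j j', h i j < χ i j') : (sponge N χ h).Valid := by
  have hsep := sponge_separated hN hlt
  refine ⟨⟨_, (mkSymb N χ h 0 fun i => ⟨0, by positivity⟩).2⟩, fun i a => (hsep.slope_pos i a).ne',
    fun i a => ?_, hsep.base_mem⟩
  rw [abs_of_pos (hsep.slope_pos i a)]
  linarith [hsep.slope_le i a]

theorem sponge_stronglyBaranski (hN : 8 ≤ N) (hlt : ∀ i j j', h i j < χ i j') :
    (sponge N χ h).StronglyBaranski := by
  have hsep := sponge_separated hN hlt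
  intro i a b hab
  rw [Set.disjoint_left]
  rintro _ ⟨x, hx, rfl⟩ ⟨y, hy, hxy⟩
  have := hsep.gap_le i a b hab x hx y hy
  rw [hxy, sub_self, abs_zero] at this
  exact this.not_gt hsep.gap_pos

theorem sponge_coordOrdering (hN : 8 ≤ N) (hχ : ∀ j i i', i < i' → χ i j < χ i' j) :
    (sponge N χ h).CoordOrdering := by
  have hN1 : (1 : ℝ) < N := by exact_mod_cast (by omega : 1 < N)
  refine ⟨1, fun a ha i i' hi => ?_⟩
  obtain ⟨j, hj⟩ := (Finset.mem_filter.1 ha).2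
  simp only [sponge, Equiv.Perm.coe_one, id_eq, hj]
  rw [abs_of_pos (by positivity), abs_of_pos (by positivity)]
  exact inv_strictAnti₀ (by positivity) (pow_lt_pow_right₀ hN1 (hχ j i i' hi))

/-- If every fibre is much lighter for `μ` than for `ν` on a set of points, then this set is small
for `μ`. -/
theorem mul_measure_light_fibres_le {Ω F : Type*} [MeasurableSpace Ω] [MeasurableSpace F]
    [Fintype F] [DiscreteMeasurableSpace F] (μ ν : Measure Ω) {f : Ω → F} (hf : Measurable f)
    (c : ℝ≥0∞) :
    c * μ {ω | c * μ (f ⁻¹' {f ω}) ≤ ν (f ⁻¹' {f ω})} ≤ ν Set.univ := by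
  set V : Finset F := Finset.univ.filter fun v => c * μ (f ⁻¹' {v}) ≤ ν (f ⁻¹' {v}) with hV
  have hset : {ω | c * μ (f ⁻¹' {f ω}) ≤ ν (f ⁻¹' {f ω})} = f ⁻¹' ↑V := by
    ext ω
    simp [hV]
  have hm (v : F) (_ : v ∈ V) : MeasurableSet (f ⁻¹' {v}) := hf (MeasurableSet.of_discrete)
  calc c * μ {ω | c * μ (f ⁻¹' {f ω}) ≤ ν (f ⁻¹' {f ω})}
      = ∑ v ∈ V, c * μ (f ⁻¹' {v}) := by
        rw [hset, ← sum_measure_preimage_singleton V hm, Finset.mul_sum]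
    _ ≤ ∑ v ∈ V, ν (f ⁻¹' {v}) := Finset.sum_le_sum fun v hv => (Finset.mem_filter.1 hv).2
    _ = ν (f ⁻¹' ↑V) := sum_measure_preimage_singleton V hm
    _ ≤ ν Set.univ := measure_mono (Set.subset_univ _)

namespace DiagIFS

/-- The set of sequences of symbols whose `i`-th coordinates agree with those of `ω` up to time
`n i`, for every `i`. -/
def approxCube (Φ : DiagIFS d A) (n : Fin d → ℕ) (ω : ℕ → Φ.Symb) : Set (ℕ → Φ.Symb) :=
  {ω' | ∀ i, ∀ k < n i, (ω' k).1 i = (ω k).1 i}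

theorem approxCube_eq_preimage (Φ : DiagIFS d A) (n : Fin d → ℕ) (ω : ℕ → Φ.Symb) :
    Φ.approxCube n ω = (fun (ω' : ℕ → Φ.Symb) (i : Fin d) (k : Fin (n i)) => (ω' k).1 i) ⁻¹'
      {fun (i : Fin d) (k : Fin (n i)) => (ω k).1 i} := by
  ext ω'
  simp only [approxCube, Set.mem_ofPred_eq, Set.mem_preimage, Set.mem_singleton_iff, funext_iff,
    Fin.forall_iff]

theorem approxCube_eq_pi (Φ : DiagIFS d A) {n : Fin d → ℕ} {K : ℕ} (hn : ∀ i, n i ≤ K)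
    (ω : ℕ → Φ.Symb) : Φ.approxCube n ω =
      Set.pi (Finset.range K) fun k => {a | ∀ i, k < n i → a.1 i = (ω k).1 i} := by
  ext ω'
  simp only [approxCube, Set.mem_ofPred_eq, Set.mem_pi, Finset.coe_range, Set.mem_Iio]
  exact ⟨fun h k _ i hk => h i k hk, fun h i k hk => h k (hk.trans_le (hn i)) i hk⟩

/-- A measure is almost surely not much lighter than another one on all approximate cubes. -/
theorem ae_eventually_approxCube_lt (Φ : DiagIFS d A) (μ ν : Measure (ℕ → Φ.Symb))
    [IsProbabilityMeasure ν] :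
    ∀ᵐ ω ∂μ, ∀ᶠ B : ℕ in atTop, ∀ n : Fin d → ℕ, (∀ i, n i ≤ B) →
      ν (Φ.approxCube n ω) < ((B : ℝ≥0∞) + 1) ^ (d + 2) * μ (Φ.approxCube n ω) := by
  set S : ℕ → Set (ℕ → Φ.Symb) := fun B => ⋃ n : Fin d → Fin (B + 1),
    {ω | ((B : ℝ≥0∞) + 1) ^ (d + 2) * μ (Φ.approxCube (fun i => n i) ω) ≤
      ν (Φ.approxCube (fun i => n i) ω)} with hS
  have hle (B : ℕ) : μ (S B) ≤ (((B : ℝ≥0∞) + 1) ^ 2)⁻¹ := by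
    have h0 : ((B : ℝ≥0∞) + 1) ≠ 0 := by simp
    have htop : ((B : ℝ≥0∞) + 1) ≠ ∞ := by finiteness
    have hn (n : Fin d → Fin (B + 1)) :
        μ {ω | ((B : ℝ≥0∞) + 1) ^ (d + 2) * μ (Φ.approxCube (fun i => n i) ω) ≤
          ν (Φ.approxCube (fun i => n i) ω)} ≤ (((B : ℝ≥0∞) + 1) ^ (d + 2))⁻¹ := by
      rw [ENNReal.le_inv_iff_mul_le, mul_comm]
      simp only [approxCube_eq_preimage]
      let mA (i : Fin d) : MeasurableSpace (A i) := ⊤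
      have (i : Fin d) : DiscreteMeasurableSpace (A i) := ⟨fun _ => trivial⟩
      refine (mul_measure_light_fibres_le μ ν ?_ _).trans (measure_univ (μ := ν)).le
      refine measurable_pi_lambda _ fun i => measurable_pi_lambda _ fun k => ?_
      exact (Measurable.of_discrete (f := fun a : Φ.Symb => a.1 i)).comp (measurable_pi_apply _)
    refine (measure_iUnion_fintype_le μ _).trans ((Finset.sum_le_sum fun n _ => hn n).trans ?_)
    simp only [Finset.sum_const, Finset.card_univ, Fintype.card_pi, Fintype.card_fin,
      Finset.prod_const, nsmul_eq_mul, Nat.cast_pow, Nat.cast_add, Nat.cast_one]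
    rw [pow_add, ENNReal.mul_inv (Or.inl (by positivity)) (Or.inl (by finiteness)), ← mul_assoc,
      ENNReal.mul_inv_cancel (by positivity) (by finiteness), one_mul]
  have hsum : ∑' B, μ (S B) ≠ ∞ := by
    refine ne_top_of_le_ne_top ?_ (ENNReal.tsum_le_tsum hle)
    have h1 : Summable fun B : ℕ => (((B : ℝ≥0) + 1) ^ 2)⁻¹ := by
      rw [← NNReal.summable_coe]
      simpa using (summable_nat_add_iff 1).2 (Real.summable_nat_pow_inv.2 one_lt_two)
    convert ENNReal.tsum_coe_ne_top_iff_summable.2 h1 with B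
    rw [ENNReal.coe_inv (by positivity)]
    simp
  filter_upwards [ae_eventually_notMem hsum] with ω hω
  filter_upwards [hω] with B hB n hn
  by_contra! H
  exact hB (Set.mem_iUnion.2 ⟨fun i => ⟨n i, Nat.lt_succ_of_le (hn i)⟩, H⟩)

end DiagIFS

/-- The uniform distribution on the allowed tuples of symbols with tag `j`. -/
noncomputable def stateMeasure (N : ℕ) (χ h : Fin d → Fin 4 → ℕ) (j : Fin 4) :
    Measure (sponge N χ h).Symb :=
  (Measure.pi fun i => ProbabilityTheory.uniformOn (Set.univ : Set (Fin (N ^ h i j)))).map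
    (mkSymb N χ h j)

instance [NeZero N] (j : Fin 4) : IsProbabilityMeasure (stateMeasure N χ h j) := by
  have (i : Fin d) : IsProbabilityMeasure
      (ProbabilityTheory.uniformOn (Set.univ : Set (Fin (N ^ h i j)))) :=
    ProbabilityTheory.isProbabilityMeasure_uniformOn Set.finite_univ Set.univ_nonempty
  exact Measure.isProbabilityMeasure_map (Measurable.of_discrete).aemeasurable

theorem ae_stateMeasure_state_eq [NeZero d] (j : Fin 4) :
    ∀ᵐ a ∂stateMeasure N χ h j, state a = j := by
  rw [stateMeasure, ae_map_iff (Measurable.of_discrete).aemeasurable MeasurableSet.of_discrete]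
  exact Eventually.of_forall fun y => tag_mkSymb j y 0

theorem stateMeasure_agree [NeZero d] [NeZero N] (c : (sponge N χ h).Symb) (p : Fin d → Prop)
    [DecidablePred p] :
    stateMeasure N χ h (state c) {a | ∀ i, p i → a.1 i = c.1 i} =
      ∏ i, if p i then ((N : ℝ≥0∞) ^ h i (state c))⁻¹ else 1 := by
  obtain ⟨y, hy⟩ := exists_mkSymb_eq c
  have hset : mkSymb N χ h (state c) ⁻¹' {a | ∀ i, p i → a.1 i = c.1 i} =
      Set.pi Set.univ fun i => if p i then {y i} else Set.univ := by
    ext z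
    simp only [Set.mem_preimage, Set.mem_ofPred_eq, Set.mem_pi, Set.mem_univ, forall_true_left]
    refine forall_congr' fun i => ?_
    rw [← congrArg (fun a : (sponge N χ h).Symb => a.1 i) hy, mkSymb_apply_eq_iff]
    split_ifs with hp <;> simp [hp]
  have (i : Fin d) : IsProbabilityMeasure
      (ProbabilityTheory.uniformOn (Set.univ : Set (Fin (N ^ h i (state c))))) :=
    ProbabilityTheory.isProbabilityMeasure_uniformOn Set.finite_univ Set.univ_nonempty
  rw [stateMeasure, Measure.map_apply Measurable.of_discrete MeasurableSet.of_discrete, hset,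
    Measure.pi_pi]
  refine Finset.prod_congr rfl fun i _ => ?_
  split_ifs
  · rw [ProbabilityTheory.uniformOn_univ, Measure.count_singleton, Fintype.card_fin, one_div,
      Nat.cast_pow]
  · exact measure_univ

theorem prod_agree_eq {s : ℕ → Fin 4} {n : Fin d → ℕ} {K : ℕ} (hn : ∀ i, n i ≤ K) :
    ∏ k ∈ Finset.range K, ∏ i, (if k < n i then ((N : ℝ≥0∞) ^ h i (s k))⁻¹ else 1) =
      ((N : ℝ≥0∞)⁻¹) ^ ∑ i, ∑ k ∈ Finset.range (n i), h i (s k) := by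
  rw [Finset.prod_comm, ← Finset.prod_pow_eq_pow_sum]
  refine Finset.prod_congr rfl fun i _ => ?_
  rw [← Finset.prod_pow_eq_pow_sum, ← Finset.prod_filter]
  refine Finset.prod_congr ?_ fun k _ => ENNReal.inv_pow
  ext k
  simp only [Finset.mem_filter, Finset.mem_range]
  exact ⟨fun hk => hk.2, fun hk => ⟨hk.trans_le (hn i), hk⟩⟩

/-- The random sequence of symbols whose tags follow `s` and which is otherwise uniform. -/
noncomputable def pathMeasure (N : ℕ) [NeZero N] (χ h : Fin d → Fin 4 → ℕ) (s : ℕ → Fin 4) :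
    Measure (ℕ → (sponge N χ h).Symb) :=
  Measure.infinitePi fun k => stateMeasure N χ h (s k)

instance [NeZero N] (s : ℕ → Fin 4) : IsProbabilityMeasure (pathMeasure N χ h s) := by
  unfold pathMeasure
  infer_instance

theorem pathMeasure_approxCube [NeZero d] [NeZero N] {s : ℕ → Fin 4}
    {ω : ℕ → (sponge N χ h).Symb} (hω : ∀ k, state (ω k) = s k) (n : Fin d → ℕ) :
    pathMeasure N χ h s ((sponge N χ h).approxCube n ω) =
      ((N : ℝ≥0∞)⁻¹) ^ ∑ i, ∑ k ∈ Finset.range (n i), h i (s k) := by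
  have hn (i : Fin d) : n i ≤ ∑ i, n i :=
    Finset.single_le_sum (fun _ _ => Nat.zero_le _) (Finset.mem_univ i)
  rw [DiagIFS.approxCube_eq_pi _ hn, pathMeasure,
    Measure.infinitePi_pi _ fun _ _ => MeasurableSet.of_discrete, ← prod_agree_eq hn]
  refine Finset.prod_congr rfl fun k _ => ?_
  simpa only [← hω k] using stateMeasure_agree (ω k) fun i => k < n i

theorem ae_pathMeasure_state_eq [NeZero d] [NeZero N] (s : ℕ → Fin 4) :
    ∀ᵐ ω ∂pathMeasure N χ h s, ∀ k, state (ω k) = s k := by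
  refine ae_all_iff.2 fun k => ?_
  have hk := (measurePreserving_eval_infinitePi
    (fun k => stateMeasure N χ h (s k)) k).quasiMeasurePreserving
  exact hk.ae (ae_stateMeasure_state_eq (s k))

/-- The product measure on sequences of symbols obtained by choosing the tags uniformly and
independently. -/
noncomputable def uniformMeasure (N : ℕ) [NeZero N] (χ h : Fin d → Fin 4 → ℕ) :
    Measure (ℕ → (sponge N χ h).Symb) :=
  Measure.infinitePi fun _ => (4 : ℝ≥0∞)⁻¹ • ∑ j, stateMeasure N χ h j

instance isProbabilityMeasure_mixture [NeZero N] :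
    IsProbabilityMeasure ((4 : ℝ≥0∞)⁻¹ • ∑ j, stateMeasure N χ h j) := by
  constructor
  simp [ENNReal.inv_mul_cancel]

instance [NeZero N] : IsProbabilityMeasure (uniformMeasure N χ h) := by
  unfold uniformMeasure
  infer_instance

theorem le_uniformMeasure_approxCube [NeZero d] [NeZero N] (ω : ℕ → (sponge N χ h).Symb)
    {n : Fin d → ℕ} {K : ℕ} (hn : ∀ i, n i ≤ K) :
    (4 : ℝ≥0∞)⁻¹ ^ K * ((N : ℝ≥0∞)⁻¹) ^ ∑ i, ∑ k ∈ Finset.range (n i), h i (state (ω k)) ≤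
      uniformMeasure N χ h ((sponge N χ h).approxCube n ω) := by
  rw [DiagIFS.approxCube_eq_pi _ hn, uniformMeasure,
    Measure.infinitePi_pi _ fun _ _ => MeasurableSet.of_discrete, ← prod_agree_eq hn,
    ← Finset.card_range K, ← Finset.prod_const, Finset.card_range, ← Finset.prod_mul_distrib]
  refine Finset.prod_le_prod' fun k _ => ?_
  rw [← stateMeasure_agree (ω k) fun i => k < n i, Measure.smul_apply, smul_eq_mul,
    Measure.finsetSum_apply]
  gcongr
  exact Finset.single_le_sum (f := fun j => stateMeasure N χ h j
    {a | ∀ i, k < n i → a.1 i = (ω k).1 i}) (fun _ _ => zero_le) (Finset.mem_univ _)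

theorem tendsto_entropy_ratio (a b : ℝ) {c : ℝ} (hc : 0 < c) :
    Tendsto (fun K : ℕ => (a * Real.log (K + 1) + K * b) / (K * c - Real.log 2)) atTop
      (𝓝 (b / c)) := by
  have h₁ : Tendsto (fun K : ℕ => Real.log ((K : ℝ) + 1) / K) atTop (𝓝 0) := by
    have h₂ : Tendsto (fun x : ℝ => Real.log x / (x - 1)) atTop (𝓝 0) := by
      have := Real.tendsto_pow_log_div_mul_add_atTop 1 (-1) 1 one_ne_zero
      simpa [sub_eq_add_neg] using this
    refine (h₂.comp (tendsto_atTop_add_const_right _ 1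
      (tendsto_natCast_atTop_atTop (R := ℝ)))).congr fun K => ?_
    simp
  have h₂ : Tendsto (fun K : ℕ => Real.log 2 / (K : ℝ)) atTop (𝓝 0) :=
    tendsto_const_div_atTop_nhds_zero_nat _
  have h₃ := ((h₁.const_mul a).add_const b).div (tendsto_const_nhds (x := c) |>.sub h₂)
    (by simpa using hc.ne')
  simp only [mul_zero, zero_add, sub_zero] at h₃
  refine h₃.congr' ?_
  filter_upwards [eventually_gt_atTop 0] with K hK
  have hK' : (K : ℝ) ≠ 0 := by positivity
  simp only [Pi.div_apply]
  rw [← mul_div_mul_left _ _ hK']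
  congr 1 <;> field_simp

theorem approxCube_subset_preimage_ball [NeZero d] (hN : 8 ≤ N)
    (hlt : ∀ i j j', h i j < χ i j') {ω : ℕ → (sponge N χ h).Symb} {n : Fin d → ℕ} {K : ℕ}
    (hn : ∀ i, K ≤ ∑ k ∈ Finset.range (n i), χ i (state (ω k))) :
    (sponge N χ h).approxCube n ω ⊆ (sponge N χ h).coding ⁻¹'
      ball ((sponge N χ h).coding ω) (2 * ((N : ℝ) ^ K)⁻¹) := by
  have hN0 : (1 : ℝ) ≤ N := by exact_mod_cast (by omega : 1 ≤ N)
  intro ω' hω'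
  rw [Set.mem_preimage, mem_ball, dist_comm, dist_pi_lt_iff (by positivity)]
  intro i
  rw [Real.dist_eq]
  refine ((sponge_separated hN hlt).abs_coding_sub_le (n := n i) (hω' i)).trans_lt ?_
  rw [prod_slope_eq]
  calc ((N : ℝ) ^ ∑ k ∈ Finset.range (n i), χ i (state (ω k)))⁻¹ ≤ ((N : ℝ) ^ K)⁻¹ :=
        inv_anti₀ (by positivity) (pow_le_pow_right₀ hN0 (hn i))
    _ < 2 * ((N : ℝ) ^ K)⁻¹ := lt_mul_of_one_lt_left (by positivity) one_lt_two

theorem log_measure_ratio_le (hN : 8 ≤ N) {q K e : ℕ} (hK : 0 < K) {t : ℝ} (he : (e : ℝ) ≤ t * K)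
    {v : ℝ} (hv : ((4 : ℝ)⁻¹ ^ K * ((N : ℝ)⁻¹) ^ e) ≤ ((K : ℝ) + 1) ^ q * v) :
    Real.log v / Real.log (2 * ((N : ℝ) ^ K)⁻¹) ≤
      (q * Real.log (K + 1) + K * (Real.log 4 + t * Real.log N)) /
        (K * Real.log N - Real.log 2) := by
  have hN0 : (0 : ℝ) < N := by exact_mod_cast (by omega : 0 < N)
  have hlog : Real.log 2 < Real.log N :=
    Real.log_lt_log two_pos (by exact_mod_cast (by omega : 2 < N))
  have hlog0 : 0 < Real.log N := (Real.log_pos one_lt_two).trans hlog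
  have hv0 : 0 < v := by
    have : (0 : ℝ) < ((K : ℝ) + 1) ^ q * v := lt_of_lt_of_le (by positivity) hv
    exact pos_of_mul_pos_right this (by positivity)
  have h₁ := Real.log_le_log (by positivity) hv
  rw [Real.log_mul (by positivity) (by positivity), Real.log_mul (by positivity) hv0.ne',
    Real.log_pow, Real.log_pow, Real.log_pow, Real.log_inv, Real.log_inv] at h₁
  have h₂ : Real.log (2 * ((N : ℝ) ^ K)⁻¹) = -(K * Real.log N - Real.log 2) := by
    rw [Real.log_mul (by positivity) (by positivity), Real.log_inv, Real.log_pow]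
    ring
  have hK1 : (1 : ℝ) ≤ K := by exact_mod_cast hK
  have h₃ : 0 < K * Real.log N - Real.log 2 := by nlinarith
  rw [h₂, div_neg, ← neg_div]
  refine div_le_div_of_nonneg_right ?_ h₃.le
  nlinarith [mul_le_mul_of_nonneg_right he hlog0.le]

theorem lowerPtDim_map_le [NeZero d] (hN : 8 ≤ N) (hlt : ∀ i j j', h i j < χ i j') {C : ℕ}
    (hC : 0 < C) {t : ℝ} {μ : Measure (ℕ → (sponge N χ h).Symb)} [IsProbabilityMeasure μ]
    {ν : Measure (ℕ → (sponge N χ h).Symb)} {ω : ℕ → (sponge N χ h).Symb}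
    (hν : ∀ n : Fin d → ℕ, ∀ K : ℕ, (∀ i, n i ≤ K) →
      (4 : ℝ≥0∞)⁻¹ ^ K * ((N : ℝ≥0∞)⁻¹) ^ ∑ i, ∑ k ∈ Finset.range (n i), h i (state (ω k)) ≤
        ν ((sponge N χ h).approxCube n ω))
    (hμ : ∀ᶠ B : ℕ in atTop, ∀ n : Fin d → ℕ, (∀ i, n i ≤ B) →
      ν ((sponge N χ h).approxCube n ω) <
        ((B : ℝ≥0∞) + 1) ^ (d + 2) * μ ((sponge N χ h).approxCube n ω))
    (H : ∃ᶠ T : ℕ in atTop, ∃ n : Fin d → ℕ, (∀ i, n i ≤ C * T) ∧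
      (∀ i, C * T ≤ ∑ k ∈ Finset.range (n i), χ i (state (ω k))) ∧
      ((∑ i, ∑ k ∈ Finset.range (n i), h i (state (ω k)) : ℕ) : ℝ) ≤ t * (C * T : ℕ)) :
    lowerPtDim (μ.map (sponge N χ h).coding) ((sponge N χ h).coding ω) ≤
      ENNReal.ofReal (t + Real.log 4 / Real.log N) := by
  have hsep := sponge_separated hN hlt
  have hN0 : (1 : ℝ) < N := by exact_mod_cast (by omega : 1 < N)
  have hlog0 : 0 < Real.log N := Real.log_pos hN0
  have hCT : Tendsto (fun T => C * T) atTop atTop := tendsto_id.const_mul_atTop' hC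
  refine ENNReal.le_of_forall_pos_le_add fun ε hε _ => ?_
  have hlim := (tendsto_entropy_ratio (d + 2 : ℕ) (Real.log 4 + t * Real.log N) hlog0).comp hCT
  have hevent := hlim.eventually_le_const (u := t + Real.log 4 / Real.log N + ε) (by
    rw [add_div, mul_div_cancel_right₀ _ hlog0.ne']
    have : (0 : ℝ) < ε := hε
    linarith)
  have hρ : Tendsto (fun T : ℕ => 2 * ((N : ℝ) ^ (C * T))⁻¹) atTop (𝓝[>] 0) := by
    refine tendsto_nhdsWithin_iff.2 ⟨?_, Eventually.of_forall fun T => ?_⟩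
    · simpa using ((tendsto_inv_atTop_zero.comp
        (tendsto_pow_atTop_atTop_of_one_lt hN0)).comp hCT).const_mul 2
    · rw [Set.mem_Ioi]
      positivity
  refine (liminf_le_of_frequently_le (hρ.frequently (p := fun ρ => ENNReal.ofReal
    (Real.log ((μ.map (sponge N χ h).coding) (ball ((sponge N χ h).coding ω) ρ)).toReal /
      Real.log ρ) ≤ ENNReal.ofReal (t + Real.log 4 / Real.log N + ε)) ?_)).trans
    (ENNReal.ofReal_add_le.trans_eq (by rw [ENNReal.ofReal_coe_nnreal]))
  refine (((H.and_eventually (hCT.eventually hμ)).and_eventually hevent).and_eventually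
    (hCT.eventually_gt_atTop 0)).mono ?_
  rintro T ⟨⟨⟨⟨n, hn₁, hn₂, hn₃⟩, hT₁⟩, hT₂⟩, hT₃⟩
  refine ENNReal.ofReal_le_ofReal ((log_measure_ratio_le hN hT₃ hn₃ ?_).trans hT₂)
  rw [hsep.measurableEmbedding_coding.map_apply]
  have hle := ((hν n _ hn₁).trans (hT₁ n hn₁).le).trans
    (mul_le_mul_right (measure_mono (approxCube_subset_preimage_ball hN hlt hn₂)) _)
  have hle' := ENNReal.toReal_mono (by finiteness) hle
  have e : (((C * T : ℕ) : ℝ≥0∞) + 1).toReal = ((C * T : ℕ) : ℝ) + 1 := by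
    rw [ENNReal.toReal_add (by finiteness) (by finiteness), ENNReal.toReal_natCast,
      ENNReal.toReal_one]
  simpa only [ENNReal.toReal_mul, ENNReal.toReal_pow, ENNReal.toReal_inv, ENNReal.toReal_natCast,
    ENNReal.toReal_ofNat, e] using hle'

/-- An upper bound for the dynamical dimension: it suffices that almost every sequence admits
approximate cubes of large mass at infinitely many scales. -/
theorem dynDim_le [NeZero d] (hN : 8 ≤ N) (hlt : ∀ i j j', h i j < χ i j') {C : ℕ}
    (hC : 0 < C) {t : ℝ}
    (H : ∀ μ : Measure (ℕ → (sponge N χ h).Symb), IsProbabilityMeasure μ → μ.map shift = μ →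
      ∀ᵐ ω ∂μ, ∃ᶠ T : ℕ in atTop, ∃ n : Fin d → ℕ, (∀ i, n i ≤ C * T) ∧
        (∀ i, C * T ≤ ∑ k ∈ Finset.range (n i), χ i (state (ω k))) ∧
        ((∑ i, ∑ k ∈ Finset.range (n i), h i (state (ω k)) : ℕ) : ℝ) ≤ t * (C * T : ℕ)) :
    (sponge N χ h).dynDim ≤ ENNReal.ofReal (t + Real.log 4 / Real.log N) := by
  have : NeZero N := ⟨by omega⟩
  refine sSup_le ?_
  rintro _ ⟨μ, hμ, hinv, rfl⟩
  refine essSup_le_of_ae_le _ ?_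
  rw [EventuallyLE, (sponge_separated hN hlt).measurableEmbedding_coding.ae_map_iff]
  filter_upwards [H μ hμ hinv, (sponge N χ h).ae_eventually_approxCube_lt μ
    (uniformMeasure N χ h)] with ω hω₁ hω₂
  exact lowerPtDim_map_le hN hlt hC (fun n K hn => le_uniformMeasure_approxCube ω hn) hω₂ hω₁

theorem map_pathMeasure_le [NeZero d] [NeZero N] (hN : 8 ≤ N) (hlt : ∀ i j j', h i j < χ i j')
    {s : ℕ → Fin 4} {K e : ℕ} {n : Fin d → ℕ}
    (hn : ∀ i, ∑ k ∈ Finset.range (n i), χ i (s k) ≤ K)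
    (he : e ≤ ∑ i, ∑ k ∈ Finset.range (n i), h i (s k)) {S : Set (Fin d → ℝ)}
    (hS : ediam S < ENNReal.ofReal
      ((2 * ∑ i, (alphabetSize N (h i) : ℝ) + 1)⁻¹ * ((N : ℝ) ^ K)⁻¹)) :
    (pathMeasure N χ h s).map (sponge N χ h).coding S ≤ ((N : ℝ≥0∞)⁻¹) ^ e := by
  have hsep := sponge_separated hN hlt
  have hN0 : (1 : ℝ) ≤ N := by exact_mod_cast (by omega : 1 ≤ N)
  have hN1 : (N : ℝ≥0∞)⁻¹ ≤ 1 := by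
    rw [ENNReal.inv_le_one]
    exact_mod_cast (by omega : 1 ≤ N)
  rw [hsep.measurableEmbedding_coding.map_apply]
  by_cases H : ∃ ω, (∀ k, state (ω k) = s k) ∧ (sponge N χ h).coding ω ∈ S
  · obtain ⟨ω, hω, hωS⟩ := H
    refine le_trans (measure_mono (t := (sponge N χ h).approxCube n ω) fun ω' hω' => ?_)
      ((pathMeasure_approxCube hω n).trans_le (pow_le_pow_right_of_le_one' hN1 he))
    intro i
    refine hsep.agree_of_abs_coding_sub_lt (lt_of_lt_of_le ?_
      (mul_le_mul_of_nonneg_left (b := ((N : ℝ) ^ K)⁻¹) ?_ hsep.gap_pos.le))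
    · rw [← Real.dist_eq]
      refine (dist_le_pi_dist _ _ i).trans_lt ?_
      have := (edist_le_ediam_of_mem hωS hω').trans_lt hS
      rw [edist_dist] at this
      exact (ENNReal.ofReal_lt_ofReal_iff (mul_pos hsep.gap_pos (by positivity))).1 this
    · rw [prod_slope_eq]
      simp only [hω]
      exact inv_anti₀ (by positivity) (pow_le_pow_right₀ hN0 (hn i))
  · refine le_trans (le_of_eq ?_) zero_le
    refine measure_mono_null (fun ω hω hst => H ⟨ω, hst, hω⟩) (ae_pathMeasure_state_eq s)

/-- A lower bound for the Hausdorff dimension: it suffices to exhibit one sequence of tags along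
which the approximate cubes have small mass at all small scales. -/
theorem le_dimH_limitSet [NeZero d] (hN : 8 ≤ N) (hlt : ∀ i j j', h i j < χ i j') {C : ℕ}
    (hC : 0 < C) {s : ℕ → Fin 4} {t : ℝ}
    (Hs : ∀ᶠ T : ℕ in atTop, ∃ n : Fin d → ℕ,
      (∀ i, ∑ k ∈ Finset.range (n i), χ i (s k) ≤ C * T) ∧
      t * (C * T : ℕ) ≤ ((∑ i, ∑ k ∈ Finset.range (n i), h i (s k) : ℕ) : ℝ))
    {t' : ℝ≥0} (ht : (t' : ℝ) < t) :
    (t' : ℝ≥0∞) ≤ dimH (sponge N χ h).limitSet := by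
  have : NeZero N := ⟨by omega⟩
  have hsep := sponge_separated hN hlt
  have hN0 : (1 : ℝ) < N := by exact_mod_cast (by omega : 1 < N)
  have hlog0 : 0 < Real.log N := Real.log_pos hN0
  have hCT : Tendsto (fun T => C * T) atTop atTop := tendsto_id.const_mul_atTop' hC
  set g : ℝ := (2 * ∑ i, (alphabetSize N (h i) : ℝ) + 1)⁻¹ with hg
  have hg0 : 0 < g := hsep.gap_pos
  set m := (pathMeasure N χ h s).map (sponge N χ h).coding with hm
  set r : ℕ → ℝ := fun T => g * ((N : ℝ) ^ (C * T))⁻¹ with hr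
  have hr0 (T : ℕ) : 0 < r T := mul_pos hg0 (by positivity)
  have hlog_r (T : ℕ) : Real.log (r T) = Real.log g - (C * T : ℕ) * Real.log N := by
    rw [sub_eq_add_neg, ← Real.log_pow, ← Real.log_inv, ← Real.log_mul hg0.ne' (by positivity)]
  have hr_tendsto : Tendsto r atTop (𝓝 0) := by
    simpa using ((tendsto_inv_atTop_zero.comp
      (tendsto_pow_atTop_atTop_of_one_lt hN0)).comp hCT).const_mul g
  have hr_anti : Antitone r := fun T T' hTT' => by
    refine mul_le_mul_of_nonneg_left (inv_anti₀ (by positivity) ?_) hg0.le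
    exact pow_le_pow_right₀ hN0.le (Nat.mul_le_mul_left _ hTT')
  have hmass : ∀ᶠ T : ℕ in atTop, ∀ S : Set (Fin d → ℝ), ediam S < ENNReal.ofReal (r T) →
      m S ≤ ENNReal.ofReal (r (T + 1) ^ (t' : ℝ)) := by
    have hlarge : Tendsto (fun T : ℕ => (t - t') * ((C * T : ℕ) * Real.log N)) atTop atTop :=
      ((tendsto_natCast_atTop_atTop.comp hCT).atTop_mul_const hlog0).const_mul_atTop
        (sub_pos.2 ht)
    filter_upwards [Hs, hlarge.eventually_ge_atTop (t' * (C * Real.log N - Real.log g))] with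
      T ⟨n, hn₁, hn₂⟩ hT S hS
    refine (map_pathMeasure_le hN hlt hn₁ le_rfl hS).trans ?_
    set e := ∑ i, ∑ k ∈ Finset.range (n i), h i (s k)
    have he : ((N : ℝ≥0∞)⁻¹) ^ e = ENNReal.ofReal (((N : ℝ)⁻¹) ^ e) := by
      rw [ENNReal.ofReal_pow (by positivity), ENNReal.ofReal_inv_of_pos (by positivity),
        ENNReal.ofReal_natCast]
    rw [he]
    refine ENNReal.ofReal_le_ofReal ?_
    rw [← Real.log_le_log_iff (by positivity) (Real.rpow_pos_of_pos (hr0 _) _),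
      Real.log_rpow (hr0 _), Real.log_pow, Real.log_inv, hlog_r]
    push_cast at hn₂ hT ⊢
    nlinarith [mul_le_mul_of_nonneg_right hn₂ hlog0.le]
  obtain ⟨T₀, hT₀⟩ := eventually_atTop.1 hmass
  have hzero (S : Set (Fin d → ℝ)) (hS : ediam S = 0) (ht' : t' ≠ 0) : m S = 0 := by
    refine le_antisymm (ge_of_tendsto' (f := fun T : ℕ => ENNReal.ofReal
      (r (T + T₀ + 1) ^ (t' : ℝ))) (x := atTop) ?_ fun T => hT₀ (T + T₀) (by omega) S ?_) zero_le
    · have h₁ : Tendsto (fun T : ℕ => r (T + T₀ + 1)) atTop (𝓝 0) :=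
        (tendsto_add_atTop_iff_nat (f := r) (T₀ + 1)).2 hr_tendsto
      have ht0 : (0 : ℝ) < t' := by exact_mod_cast pos_iff_ne_zero.2 ht'
      have h₂ := h₁.rpow_const (p := (t' : ℝ)) (Or.inr ht0.le)
      rw [Real.zero_rpow ht0.ne'] at h₂
      simpa using ENNReal.tendsto_ofReal h₂
    · rw [hS]
      exact ENNReal.ofReal_pos.2 (hr0 _)
  have hmain : m ≤ μH[(t' : ℝ)] := by
    refine Measure.le_hausdorffMeasure _ _ (ENNReal.ofReal (r T₀ / 2))
      (ENNReal.ofReal_pos.2 (half_pos (hr0 _))) fun S hS => ?_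
    rcases eq_or_ne t' 0 with rfl | ht'
    · have : IsProbabilityMeasure m :=
        Measure.isProbabilityMeasure_map hsep.continuous_coding.measurable.aemeasurable
      simpa using prob_le_one
    rcases eq_or_ne (ediam S) 0 with h0 | h0
    · rw [hzero S h0 ht']
      exact zero_le
    have hfin : ediam S ≠ ∞ := ne_top_of_le_ne_top ENNReal.ofReal_ne_top hS
    have hpos : 0 < (ediam S).toReal := ENNReal.toReal_pos h0 hfin
    have hex : ∃ T, r T ≤ (ediam S).toReal := (hr_tendsto.eventually_le_const hpos).exists
    have hfind := Nat.find_spec hex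
    have hlt₀ : T₀ < Nat.find hex := by
      refine (Nat.lt_find_iff hex _).2 fun T hT => not_le.2 ?_
      calc (ediam S).toReal ≤ r T₀ / 2 :=
            ENNReal.toReal_le_of_le_ofReal (half_pos (hr0 _)).le hS
        _ < r T₀ := half_lt_self (hr0 _)
        _ ≤ r T := hr_anti hT
    obtain ⟨T, hT⟩ := Nat.exists_eq_add_of_le' (by omega : 1 ≤ Nat.find hex)
    have hTlt : (ediam S).toReal < r T := not_le.1 (Nat.find_min hex (by omega))
    rw [hT] at hfind
    refine (hT₀ T (by omega) S ?_).trans ?_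
    · rw [← ENNReal.ofReal_toReal hfin]
      exact (ENNReal.ofReal_lt_ofReal_iff (hr0 _)).2 hTlt
    · rw [← ENNReal.ofReal_rpow_of_pos (hr0 _)]
      refine ENNReal.rpow_le_rpow ?_ t'.2
      rw [← ENNReal.ofReal_toReal hfin]
      exact ENNReal.ofReal_le_ofReal hfind
  refine le_dimH_of_hausdorffMeasure_ne_zero fun h0 => ?_
  have h1 : m (sponge N χ h).limitSet = 0 := le_antisymm ((hmain _).trans_eq h0) zero_le
  rw [hm, hsep.measurableEmbedding_coding.map_apply, DiagIFS.limitSet, Set.preimage_range,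
    measure_univ] at h1
  exact one_ne_zero h1

end Construction

/-- The first coordinates of the four corners of the square `[-1, 1]²`, in counterclockwise
order. -/
def cornerX : Fin 4 → ℝ := ![1, 1, -1, -1]

/-- The second coordinates of the four corners of the square `[-1, 1]²`, in counterclockwise
order. -/
def cornerY : Fin 4 → ℝ := ![-1, 1, 1, -1]

/-- The products of the two coordinates of the corners of the square `[-1, 1]²`. -/
def cornerXY : Fin 4 → ℝ := ![-1, 1, -1, 1]

/-- The sequence of corners that is constant on each dyadic block `[2 ^ p, 2 ^ (p + 1))` and
moves to the next corner from one block to the next. -/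
def spiral (k : ℕ) : Fin 4 := Fin.ofNat 4 (Nat.log 2 k)

/-- Partial sums of a function of the corners along `spiral`, in closed form. -/
theorem sum_spiral {f α : Fin 4 → ℝ} (h₀ : α 0 + f 0 = 2 * α 1)
    (h₁ : α 1 + f 1 = 2 * α 2) (h₂ : α 2 + f 2 = 2 * α 3) (h₃ : α 3 + f 3 = 2 * α 0) (p : ℕ) :
    ∀ n : ℕ, 2 ^ p ≤ n → n ≤ 2 ^ (p + 1) →
      ∑ k ∈ Finset.range n, f (spiral k) =
        2 ^ p * α (Fin.ofNat 4 p) + f (Fin.ofNat 4 p) * (n - 2 ^ p) + (f 0 - α 0) := by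
  have hα : ∀ j, α j + f j = 2 * α (j + 1)
    | 0 => h₀
    | 1 => h₁
    | 2 => h₂
    | 3 => h₃
  have step : ∀ p : ℕ, (∑ k ∈ Finset.range (2 ^ p), f (spiral k) =
      2 ^ p * α (Fin.ofNat 4 p) + (f 0 - α 0)) → ∀ n : ℕ, 2 ^ p ≤ n → n ≤ 2 ^ (p + 1) →
      ∑ k ∈ Finset.range n, f (spiral k) =
        2 ^ p * α (Fin.ofNat 4 p) + f (Fin.ofNat 4 p) * (n - 2 ^ p) + (f 0 - α 0) := by
    intro p hp n hn
    induction n, hn using Nat.le_induction with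
    | base => intro _; rw [hp]; push_cast; ring
    | succ n hn ih =>
      intro h
      have hs : spiral n = (Fin.ofNat 4 p) := by
        rw [spiral, Nat.log_eq_of_pow_le_of_lt_pow hn (by omega)]
      rw [Finset.sum_range_succ, ih (by omega), hs]
      push_cast
      ring
  refine step p ?_
  induction p with
  | zero => simp [spiral]
  | succ p ih =>
    rw [step p ih (2 ^ (p + 1)) (Nat.pow_le_pow_right two_pos (Nat.le_succ p)) le_rfl]
    have := hα (Fin.ofNat 4 p)
    have e : Fin.ofNat 4 (p + 1) = Fin.ofNat 4 p + 1 := by ext; simp [Fin.val_add]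
    push_cast
    rw [pow_succ, e]
    linear_combination 2 ^ p * this

theorem sum_spiral_cornerX {p n : ℕ} (h : 2 ^ p ≤ n) (h' : n ≤ 2 ^ (p + 1)) :
    ∑ k ∈ Finset.range n, cornerX (spiral k) =
      2 ^ p * (![-3 / 5, 1 / 5, 3 / 5, -1 / 5] : Fin 4 → ℝ) (Fin.ofNat 4 p) +
        cornerX (Fin.ofNat 4 p) * (n - 2 ^ p) + 8 / 5 := by
  rw [sum_spiral (α := ![-3 / 5, 1 / 5, 3 / 5, -1 / 5]) _ _ _ _ p n h h']
  · norm_num [cornerX]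
  all_goals (simp [cornerX]; norm_num)

theorem sum_spiral_cornerY {p n : ℕ} (h : 2 ^ p ≤ n) (h' : n ≤ 2 ^ (p + 1)) :
    ∑ k ∈ Finset.range n, cornerY (spiral k) =
      2 ^ p * (![-1 / 5, -3 / 5, 1 / 5, 3 / 5] : Fin 4 → ℝ) (Fin.ofNat 4 p) +
        cornerY (Fin.ofNat 4 p) * (n - 2 ^ p) - 4 / 5 := by
  rw [sum_spiral (α := ![-1 / 5, -3 / 5, 1 / 5, 3 / 5]) _ _ _ _ p n h h']
  · norm_num [cornerY]; ring
  all_goals (simp [cornerY]; norm_num)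

theorem sum_spiral_cornerXY {p n : ℕ} (h : 2 ^ p ≤ n) (h' : n ≤ 2 ^ (p + 1)) :
    ∑ k ∈ Finset.range n, cornerXY (spiral k) =
      2 ^ p * (![1 / 3, -1 / 3, 1 / 3, -1 / 3] : Fin 4 → ℝ) (Fin.ofNat 4 p) +
        cornerXY (Fin.ofNat 4 p) * (n - 2 ^ p) - 4 / 3 := by
  rw [sum_spiral (α := ![1 / 3, -1 / 3, 1 / 3, -1 / 3]) _ _ _ _ p n h h']
  · norm_num [cornerXY]; ring
  all_goals (simp [cornerXY]; norm_num)

theorem abs_sum_le_of_abs_le_one {f : ℕ → ℝ} (hf : ∀ k, |f k| ≤ 1) (n : ℕ) :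
    |∑ k ∈ Finset.range n, f k| ≤ n := by
  refine (Finset.abs_sum_le_sum_abs _ _).trans ?_
  simpa using Finset.sum_le_sum fun k (_ : k ∈ Finset.range n) => hf k

theorem abs_sum_sub_sum_le {f : ℕ → ℝ} (hf : ∀ k, |f k| ≤ 1) {m n : ℕ} (h : m ≤ n) :
    |∑ k ∈ Finset.range n, f k - ∑ k ∈ Finset.range m, f k| ≤ n - m := by
  obtain ⟨r, rfl⟩ := Nat.exists_eq_add_of_le h
  rw [Finset.sum_range_add, add_sub_cancel_left]
  simpa using abs_sum_le_of_abs_le_one (fun k => hf (m + k)) r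

theorem abs_cornerX_le (j : Fin 4) : |cornerX j| ≤ 1 := by
  fin_cases j <;> norm_num [cornerX]

theorem abs_cornerY_le (j : Fin 4) : |cornerY j| ≤ 1 := by
  fin_cases j <;> norm_num [cornerY]

theorem abs_cornerXY_le (j : Fin 4) : |cornerXY j| ≤ 1 := by
  fin_cases j <;> norm_num [cornerXY]

/-- The time at which a walk with drift `100` and steps bounded by `1` passes the level `M`. -/
theorem exists_passage_time {f : ℕ → ℝ} (hf : ∀ k, |f k| ≤ 1) {M : ℝ} (hM : 0 ≤ M) :
    ∃ n : ℕ, 100 * (n : ℝ) + ∑ k ∈ Finset.range n, f k ≤ M ∧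
      M < 100 * ((n + 1 : ℕ) : ℝ) + ∑ k ∈ Finset.range (n + 1), f k := by
  by_contra! H
  have key : ∀ n : ℕ, 100 * (n : ℝ) + ∑ k ∈ Finset.range n, f k ≤ M := by
    intro n
    induction n with
    | zero => simpa using hM
    | succ n ih => exact H n ih
  obtain ⟨n, hn⟩ := exists_nat_gt M
  have h1 := key n
  have h2 := (abs_le.1 (abs_sum_le_of_abs_le_one hf n)).1
  have h3 : (0 : ℝ) ≤ n := n.cast_nonneg
  linarith

/-- The dimension sum at the scale indexed by `T` along a sequence of corners. -/
noncomputable def dimSum (s : ℕ → Fin 4) (n₁ n₂ T : ℕ) : ℝ :=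
  (100 * n₁ + ∑ k ∈ Finset.range n₁, cornerX (s k) -
      100 * ∑ k ∈ Finset.range n₁, cornerY (s k) - ∑ k ∈ Finset.range n₁, cornerXY (s k)) +
    16 * (100 * n₂ + ∑ k ∈ Finset.range n₂, cornerY (s k) +
      100 * ∑ k ∈ Finset.range n₂, cornerX (s k) + ∑ k ∈ Finset.range n₂, cornerXY (s k)) +
    25600 * (2 * T + ∑ k ∈ Finset.range T, cornerY (s k) - ∑ k ∈ Finset.range T, cornerX (s k))

theorem exists_block {p n : ℕ} (h : 2 ^ p ≤ n) (h' : n ≤ 2 ^ (p + 3)) :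
    ∃ q, (q = p ∨ q = p + 1 ∨ q = p + 2) ∧ 2 ^ q ≤ n ∧ n ≤ 2 ^ (q + 1) := by
  rcases le_total n (2 ^ (p + 1)) with h1 | h1
  · exact ⟨p, Or.inl rfl, h, h1⟩
  rcases le_total n (2 ^ (p + 2)) with h2 | h2
  · exact ⟨p + 1, Or.inr (Or.inl rfl), h1, h2⟩
  · exact ⟨p + 2, Or.inr (Or.inr rfl), h2, h'⟩

set_option maxHeartbeats 4000000 in
/-- Along the spiral the dimension sum exceeds the stationary value at every scale. -/
theorem spiral_dimSum_ge : ∀ᶠ T : ℕ in atTop, ∃ n₁ n₂ : ℕ,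
    100 * (n₁ : ℝ) + ∑ k ∈ Finset.range n₁, cornerX (spiral k) ≤ 25600 * T ∧
    16 * (100 * (n₂ : ℝ) + ∑ k ∈ Finset.range n₂, cornerY (spiral k)) ≤ 25600 * T ∧
    (4 + 3 / 1000) * (25600 * (T : ℝ)) ≤ dimSum spiral n₁ n₂ T := by
  filter_upwards [eventually_ge_atTop (10 ^ 10)] with T hT
  obtain ⟨n₁, h₁, h₁'⟩ := exists_passage_time (f := fun k => cornerX (spiral k))
    (fun k => abs_cornerX_le _) (M := 25600 * (T : ℝ)) (by positivity)
  obtain ⟨n₂, h₂, h₂'⟩ := exists_passage_time (f := fun k => cornerY (spiral k))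
    (fun k => abs_cornerY_le _) (M := 1600 * (T : ℝ)) (by positivity)
  refine ⟨n₁, n₂, h₁, by linarith, ?_⟩
  rw [Finset.sum_range_succ] at h₁' h₂'
  have hx := (abs_le.1 (abs_cornerX_le (spiral n₁))).2
  have hy := (abs_le.1 (abs_cornerY_le (spiral n₂))).2
  push_cast at h₁' h₂'
  replace h₁' : 25600 * (T : ℝ) - 101 ≤
      100 * n₁ + ∑ k ∈ Finset.range n₁, cornerX (spiral k) := by linarith
  replace h₂' : 1600 * (T : ℝ) - 101 ≤
      100 * n₂ + ∑ k ∈ Finset.range n₂, cornerY (spiral k) := by linarith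
  have hX := abs_le.1 (abs_sum_le_of_abs_le_one (fun k => abs_cornerX_le (spiral k)) n₁)
  have hY := abs_le.1 (abs_sum_le_of_abs_le_one (fun k => abs_cornerY_le (spiral k)) n₂)
  have hTr : (10 : ℝ) ^ 10 ≤ T := by exact_mod_cast hT
  obtain ⟨p, hp, hp'⟩ : ∃ p, 2 ^ (p + 1) ≤ T ∧ T ≤ 2 ^ (p + 2) := by
    have h1 : 2 ^ Nat.log 2 T ≤ T := Nat.pow_log_le_self 2 (by omega)
    have h2 : T < 2 ^ (Nat.log 2 T + 1) := Nat.lt_pow_succ_log_self one_lt_two T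
    have h3 : 1 ≤ Nat.log 2 T := Nat.log_pos one_lt_two (by omega)
    obtain ⟨q, hq⟩ := Nat.exists_eq_add_of_le' h3
    rw [hq] at h1 h2
    exact ⟨q, h1, h2.le⟩
  have pow_add_real : ∀ r : ℕ, (2 : ℝ) ^ (p + r) = 2 ^ p * 2 ^ r := fun r => pow_add 2 p r
  have hpr : (2 : ℝ) ^ (p + 1) ≤ T := by exact_mod_cast hp
  have hpr' : (T : ℝ) ≤ 2 ^ (p + 2) := by exact_mod_cast hp'
  rw [pow_add_real] at hpr hpr'
  obtain ⟨q₁, hq₁, ha₁, hb₁⟩ := exists_block (p := p + 8) (n := n₁)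
    (by
      have : ((2 : ℝ) ^ (p + 8)) ≤ n₁ := by
        rw [pow_add_real]; norm_num1 at *; linarith
      exact_mod_cast this)
    (by
      have : (n₁ : ℝ) ≤ 2 ^ (p + 11) := by
        rw [pow_add_real]; norm_num1 at *; linarith
      exact_mod_cast this)
  obtain ⟨q₂, hq₂, ha₂, hb₂⟩ := exists_block (p := p + 4) (n := n₂)
    (by
      have : ((2 : ℝ) ^ (p + 4)) ≤ n₂ := by
        rw [pow_add_real]; norm_num1 at *; linarith
      exact_mod_cast this)
    (by
      have : (n₂ : ℝ) ≤ 2 ^ (p + 7) := by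
        rw [pow_add_real]; norm_num1 at *; linarith
      exact_mod_cast this)
  have ha₁' : (2 : ℝ) ^ q₁ ≤ n₁ := by exact_mod_cast ha₁
  have hb₁' : (n₁ : ℝ) ≤ 2 ^ (q₁ + 1) := by exact_mod_cast hb₁
  have ha₂' : (2 : ℝ) ^ q₂ ≤ n₂ := by exact_mod_cast ha₂
  have hb₂' : (n₂ : ℝ) ≤ 2 ^ (q₂ + 1) := by exact_mod_cast hb₂
  unfold dimSum
  rw [sum_spiral_cornerX ha₁ hb₁] at h₁ h₁'
  rw [sum_spiral_cornerY ha₂ hb₂] at h₂ h₂'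
  rw [sum_spiral_cornerX ha₁ hb₁, sum_spiral_cornerY ha₂ hb₂,
    sum_spiral_cornerX ha₂ hb₂, sum_spiral_cornerY ha₁ hb₁, sum_spiral_cornerXY ha₁ hb₁,
    sum_spiral_cornerXY ha₂ hb₂, sum_spiral_cornerX hp hp', sum_spiral_cornerY hp hp']
  clear hX hY ha₁ ha₂ hb₁ hb₂ hp hp' hT hx hy
  obtain ⟨c, hc, hpc⟩ : ∃ c, (c = 0 ∨ c = 1 ∨ c = 2 ∨ c = 3) ∧ p % 4 = c := ⟨p % 4, by omega, rfl⟩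
  have ofNat_add : ∀ r : ℕ, Fin.ofNat 4 (p + r) = Fin.ofNat 4 (c + r) := by
    intro r; ext; simp only [Fin.ofNat]; omega
  rcases hq₁ with rfl | rfl | rfl <;> rcases hq₂ with rfl | rfl | rfl <;>
  · simp only [add_assoc, Nat.reduceAdd, ofNat_add, pow_add_real]
      at ha₁' hb₁' ha₂' hb₂' h₁ h₁' h₂ h₂' ⊢
    clear ofNat_add pow_add_real hpc
    generalize (2 : ℝ) ^ p = P at *
    generalize (n₁ : ℝ) = N₁ at *
    generalize (n₂ : ℝ) = N₂ at *
    generalize (T : ℝ) = T' at *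
    rcases hc with rfl | rfl | rfl | rfl <;>
      simp [cornerX, cornerY, cornerXY, Fin.ofNat] at h₁ h₁' h₂ h₂' ⊢ <;>
      norm_num1 at * <;> linarith

/-- The dimension sum at the scale `T` is close to the stationary value as soon as the averages
of the corners along `s` are almost constant over the window `[T, 512 T]`. -/
theorem exists_dimSum_le {s : ℕ → Fin 4} {T : ℕ} (hT : 10 ^ 8 ≤ T) {X Y Z : ℝ}
    (hX : |X| ≤ 1) (hY : |Y| ≤ 1) (hZ : |Z| ≤ 1)
    (hsX : ∀ n : ℕ, T ≤ n → n ≤ 512 * T →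
      |∑ k ∈ Finset.range n, cornerX (s k) - X * n| ≤ 1 / 10 ^ 5 * n)
    (hsY : ∀ n : ℕ, T ≤ n → n ≤ 512 * T →
      |∑ k ∈ Finset.range n, cornerY (s k) - Y * n| ≤ 1 / 10 ^ 5 * n)
    (hsZ : ∀ n : ℕ, T ≤ n → n ≤ 512 * T →
      |∑ k ∈ Finset.range n, cornerXY (s k) - Z * n| ≤ 1 / 10 ^ 5 * n) :
    ∃ n₁ ≤ 512 * T, ∃ n₂ ≤ 512 * T,
      25600 * (T : ℝ) ≤ 100 * (n₁ : ℝ) + ∑ k ∈ Finset.range n₁, cornerX (s k) ∧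
      25600 * (T : ℝ) ≤ 16 * (100 * (n₂ : ℝ) + ∑ k ∈ Finset.range n₂, cornerY (s k)) ∧
      dimSum s n₁ n₂ T ≤ (4 + 1 / 1000) * (25600 * (T : ℝ)) := by
  have hTr : (10 : ℝ) ^ 8 ≤ T := by exact_mod_cast hT
  obtain ⟨n₁, h₁, h₁'⟩ := exists_passage_time (f := fun k => cornerX (s k))
    (fun k => abs_cornerX_le _) (M := 25600 * (T : ℝ)) (by positivity)
  obtain ⟨n₂, h₂, h₂'⟩ := exists_passage_time (f := fun k => cornerY (s k))
    (fun k => abs_cornerY_le _) (M := 1600 * (T : ℝ)) (by positivity)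
  have hr₁ : 100 * ((n₁ + 1 : ℕ) : ℝ) + ∑ k ∈ Finset.range (n₁ + 1), cornerX (s k) ≤
      25600 * T + 101 := by
    rw [Finset.sum_range_succ]
    have := (abs_le.1 (abs_cornerX_le (s n₁))).2
    push_cast
    linarith
  have hr₂ : 100 * ((n₂ + 1 : ℕ) : ℝ) + ∑ k ∈ Finset.range (n₂ + 1), cornerY (s k) ≤
      1600 * T + 101 := by
    rw [Finset.sum_range_succ]
    have := (abs_le.1 (abs_cornerY_le (s n₂))).2
    push_cast
    linarith
  generalize n₁ + 1 = N₁ at *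
  generalize n₂ + 1 = N₂ at *
  clear h₁ h₂ n₁ n₂
  have hA := abs_le.1 (abs_sum_le_of_abs_le_one (fun k => abs_cornerX_le (s k)) N₁)
  have hB := abs_le.1 (abs_sum_le_of_abs_le_one (fun k => abs_cornerY_le (s k)) N₂)
  have window₁ : T ≤ N₁ ∧ N₁ ≤ 512 * T := by
    constructor
    · exact_mod_cast (by linarith : (T : ℝ) ≤ N₁)
    · exact_mod_cast (by linarith : (N₁ : ℝ) ≤ 512 * T)
  have window₂ : T ≤ N₂ ∧ N₂ ≤ 512 * T := by
    constructor
    · exact_mod_cast (by linarith : (T : ℝ) ≤ N₂)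
    · exact_mod_cast (by linarith : (N₂ : ℝ) ≤ 512 * T)
  refine ⟨N₁, window₁.2, N₂, window₂.2, h₁'.le, by linarith, ?_⟩
  have x₁ := hsX N₁ window₁.1 window₁.2
  have y₁ := abs_le.1 (hsY N₁ window₁.1 window₁.2)
  have z₁ := abs_le.1 (hsZ N₁ window₁.1 window₁.2)
  have x₂ := abs_le.1 (hsX N₂ window₂.1 window₂.2)
  have y₂ := hsY N₂ window₂.1 window₂.2
  have z₂ := abs_le.1 (hsZ N₂ window₂.1 window₂.2)
  have x₃ := abs_le.1 (hsX T le_rfl (by omega))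
  have y₃ := abs_le.1 (hsY T le_rfl (by omega))
  unfold dimSum
  generalize ∑ k ∈ Finset.range N₁, cornerX (s k) = a₁ at *
  generalize ∑ k ∈ Finset.range N₁, cornerY (s k) = b₁ at *
  generalize ∑ k ∈ Finset.range N₁, cornerXY (s k) = c₁ at *
  generalize ∑ k ∈ Finset.range N₂, cornerX (s k) = a₂ at *
  generalize ∑ k ∈ Finset.range N₂, cornerY (s k) = b₂ at *
  generalize ∑ k ∈ Finset.range N₂, cornerXY (s k) = c₂ at *
  generalize ∑ k ∈ Finset.range T, cornerX (s k) = a₃ at *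
  generalize ∑ k ∈ Finset.range T, cornerY (s k) = b₃ at *
  have bound {u v w : ℝ} (hu : |u| ≤ w) (hv : |v| ≤ 1) : v * u ≤ w := by
    refine (le_abs_self _).trans ?_
    rw [abs_mul]
    calc |v| * |u| ≤ 1 * w := mul_le_mul hv hu (abs_nonneg _) zero_le_one
      _ = w := one_mul w
  have e₁ : -Y * (100 * N₁ + a₁ - 25600 * T - (a₁ - X * N₁)) ≤ 101 + 1 / 10 ^ 5 * N₁ := by
    refine bound ((abs_sub _ _).trans (add_le_add ?_ x₁)) (by rwa [abs_neg])
    rw [abs_le]; constructor <;> linarith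
  have e₂ : X * (100 * N₂ + b₂ - 1600 * T - (b₂ - Y * N₂)) ≤ 101 + 1 / 10 ^ 5 * N₂ := by
    refine bound ((abs_sub _ _).trans (add_le_add ?_ y₂)) hX
    rw [abs_le]; constructor <;> linarith
  have e₃ : (Z - X * Y) / 2 * (16 * N₂ - N₁) ≤ 3 / 10 ^ 4 * (25600 * T) := by
    refine bound ?_ ?_
    · rw [abs_le]; constructor <;> linarith
    · have h₁ := abs_le.1 (show |X * Y| ≤ 1 by
        rw [abs_mul]; exact mul_le_one₀ hX (abs_nonneg _) hY)
      have h₂ := abs_le.1 hZ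
      rw [abs_le]; constructor <;> linarith
  have x₁ := abs_le.1 x₁
  have y₂ := abs_le.1 y₂
  nlinarith

theorem ae_frequently_notMem {Ω : Type*} [MeasurableSpace Ω] {μ : Measure Ω} {B : ℕ → Set Ω}
    (hB : Tendsto (fun T => μ (B T)) atTop (𝓝 0)) : ∀ᵐ ω ∂μ, ∃ᶠ T in atTop, ω ∉ B T := by
  have h (T₀ : ℕ) : ∀ᵐ ω ∂μ, ∃ T ≥ T₀, ω ∉ B T := by
    rw [ae_iff]
    push Not
    refine le_antisymm (ge_of_tendsto hB ?_) zero_le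
    filter_upwards [eventually_ge_atTop T₀] with T hT
    exact measure_mono fun ω hω => hω T hT
  filter_upwards [ae_all_iff.2 h] with ω hω
  exact frequently_atTop.2 hω

/-- A weak form of the mean ergodic theorem. -/
theorem exists_tendstoInMeasure_birkhoffAverage {Ω : Type*} [MeasurableSpace Ω] {μ : Measure Ω}
    {F : Ω → Ω} (hF : MeasurePreserving F μ μ) {f : Ω → ℝ} (hf : MemLp f 2 μ) :
    ∃ g : Ω → ℝ, TendstoInMeasure μ (fun n => birkhoffAverage ℝ F f n) atTop g := by
  set U := (Lp.compMeasurePreservingₗᵢ (E := ℝ) (p := 2) ℝ F hF).toContinuousLinearMap with hU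
  have key := U.tendsto_birkhoffAverage_orthogonalProjection
    (LinearIsometry.norm_toContinuousLinearMap_le _) (hf.toLp f)
  refine ⟨_, (tendstoInMeasure_of_tendsto_Lp key).congr (fun n => ?_) EventuallyEq.rfl⟩
  have hiter (k : ℕ) : (⇑U)^[k] (hf.toLp f) =ᵐ[μ] f ∘ F^[k] := by
    have : (⇑U)^[k] = Lp.compMeasurePreserving F^[k] (hF.iterate k) :=
      Lp.compMeasurePreserving_iterate hF k
    rw [this, Lp.toLp_compMeasurePreserving]
    exact MemLp.coeFn_toLp _
  have hsum : ⇑(birkhoffSum U _root_.id n (hf.toLp f) : Lp ℝ 2 μ) =ᵐ[μ] birkhoffSum F f n := by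
    induction n with
    | zero => exact Lp.coeFn_zero _ _ _
    | succ n ih =>
      rw [birkhoffSum_succ]
      filter_upwards [ih, hiter n, Lp.coeFn_add (birkhoffSum U _root_.id n (hf.toLp f))
        ((⇑U)^[n] (hf.toLp f))] with ω h₁ h₂ h₃
      rw [birkhoffSum_succ, ← h₁]
      refine h₃.trans ?_
      rw [Pi.add_apply, h₂, Function.comp_apply]
  filter_upwards [hsum, Lp.coeFn_smul (n : ℝ)⁻¹ (birkhoffSum U _root_.id n (hf.toLp f))] with
    ω h₁ h₂
  exact h₂.trans (congrArg ((n : ℝ)⁻¹ • ·) h₁)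

theorem ae_frequently_birkhoffSum_near {Ω ι : Type*} [Finite ι] [MeasurableSpace Ω]
    {μ : Measure Ω} [IsProbabilityMeasure μ] {F : Ω → Ω} (hF : MeasurePreserving F μ μ)
    {f : ι → Ω → ℝ} (hf : ∀ i, Measurable (f i)) (hf₁ : ∀ i ω, |f i ω| ≤ 1) {ε : ℝ} (hε : 0 < ε)
    {q : ℕ} (hq : 0 < q) :
    ∀ᵐ ω ∂μ, ∃ᶠ T : ℕ in atTop, ∀ i, ∃ X : ℝ, |X| ≤ 1 ∧ ∀ n, T ≤ n → n ≤ q * T →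
      |∑ k ∈ Finset.range n, f i (F^[k] ω) - X * n| ≤ ε * n := by
  choose g hg using fun i => exists_tendstoInMeasure_birkhoffAverage hF
    (MemLp.of_bound (p := 2) (hf i).aestronglyMeasurable 1 (ae_of_all μ (hf₁ i)))
  obtain ⟨p, hp⟩ := exists_nat_gt (4 / ε)
  have hp0 : 0 < p := by
    have : (0 : ℝ) < p := (by positivity : (0 : ℝ) < 4 / ε).trans hp
    exact_mod_cast this
  have hpε : 4 < ε * p := by rwa [div_lt_iff₀' hε] at hp
  cases nonempty_fintype ι
  set B : ℕ → Set Ω := fun T => ⋃ i ∈ (Finset.univ : Finset ι), ⋃ j ∈ Finset.Icc p (q * p),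
    {ω | ε / 4 ≤ ‖birkhoffAverage ℝ F (f i) (j * T) ω - g i ω‖} with hB
  have hB0 : Tendsto (fun T => μ (B T)) atTop (𝓝 0) := by
    refine tendsto_of_tendsto_of_tendsto_of_le_of_le (h := fun T => ∑ i, ∑ j ∈ Finset.Icc p (q * p),
      μ {ω | ε / 4 ≤ ‖birkhoffAverage ℝ F (f i) (j * T) ω - g i ω‖}) tendsto_const_nhds ?_
      (fun _ => zero_le) fun T => (measure_biUnion_finset_le _ _).trans
        (Finset.sum_le_sum fun i _ => measure_biUnion_finset_le _ _)
    rw [show (0 : ℝ≥0∞) = ∑ i : ι, ∑ j ∈ Finset.Icc p (q * p), 0 by simp]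
    refine tendsto_finsetSum _ fun i _ => tendsto_finsetSum _ fun j hj => ?_
    have hj0 : 0 < j := hp0.trans_le (Finset.mem_Icc.1 hj).1
    exact (tendstoInMeasure_iff_norm.1 (hg i) (ε / 4) (by positivity)).comp
      (tendsto_id.const_mul_atTop' hj0)
  filter_upwards [ae_frequently_notMem hB0] with ω hω
  refine (tendsto_id.const_mul_atTop' hp0).frequently
    ((hω.and_eventually (eventually_ge_atTop 1)).mono ?_)
  rintro T ⟨hT, hT1⟩ i
  set S : ℕ → ℝ := fun n => ∑ k ∈ Finset.range n, f i (F^[k] ω) with hS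
  have hSj (j : ℕ) (hj : p ≤ j) (hj' : j ≤ q * p) :
      |S (j * T) - g i ω * (j * T : ℕ)| ≤ ε / 4 * (j * T : ℕ) := by
    have hjT : (0 : ℝ) < (j * T : ℕ) := by exact_mod_cast Nat.mul_pos (hp0.trans_le hj) hT1
    have h : |((j * T : ℕ) : ℝ)⁻¹ * S (j * T) - g i ω| < ε / 4 := by
      by_contra! h
      exact hT (mem_biUnion (Finset.mem_univ i) (mem_biUnion (Finset.mem_Icc.2 ⟨hj, hj'⟩) h))
    calc |S (j * T) - g i ω * (j * T : ℕ)|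
        = |((j * T : ℕ) : ℝ)⁻¹ * S (j * T) - g i ω| * (j * T : ℕ) := by
          rw [← abs_of_pos hjT, ← abs_mul, abs_of_pos hjT, sub_mul, mul_right_comm,
            inv_mul_cancel₀ hjT.ne', one_mul]
      _ ≤ _ := mul_le_mul_of_nonneg_right h.le hjT.le
  have hpT : (0 : ℝ) < (p * T : ℕ) := by exact_mod_cast Nat.mul_pos hp0 hT1
  have hX : |S (p * T) / (p * T : ℕ)| ≤ 1 := by
    rw [abs_div, abs_of_pos hpT, div_le_one hpT]
    exact abs_sum_le_of_abs_le_one (fun k => hf₁ i _) _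
  set X := S (p * T) / (p * T : ℕ) with hXdef
  have hXS : S (p * T) = X * (p * T : ℕ) := by rw [hXdef, div_mul_cancel₀ _ hpT.ne']
  have hXg : |X - g i ω| ≤ ε / 4 := by
    have := hSj p le_rfl (Nat.le_mul_of_pos_left p hq)
    rw [hXS, ← sub_mul, abs_mul, abs_of_pos hpT] at this
    exact le_of_mul_le_mul_right this hpT
  refine ⟨X, hX, fun n hn hn' => ?_⟩
  set j := n / T with hj
  have hjn : j * T ≤ n := Nat.div_mul_le_self n T
  have hnj : n < (j + 1) * T := Nat.lt_mul_of_div_lt (Nat.lt_succ_self _) hT1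
  have h₁ := hSj j ((Nat.le_div_iff_mul_le hT1).2 hn) (Nat.div_le_of_le_mul (by
    rw [id] at hn'; linarith))
  have h₂ : |S n - S (j * T)| ≤ n - (j * T : ℕ) :=
    abs_sum_sub_sum_le (fun k => hf₁ i (F^[k] ω)) hjn
  change |S n - X * n| ≤ ε * n
  have h₃ : |X - g i ω| * (j * T : ℕ) ≤ ε / 4 * (j * T : ℕ) :=
    mul_le_mul_of_nonneg_right hXg (Nat.cast_nonneg _)
  have h₄ : |X| * (n - (j * T : ℕ)) ≤ 1 * (n - (j * T : ℕ)) :=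
    mul_le_mul_of_nonneg_right hX (sub_nonneg.2 (by exact_mod_cast hjn))
  have h₅ : ((j * T : ℕ) : ℝ) ≤ n := by exact_mod_cast hjn
  have h₆ : (n : ℝ) ≤ (j * T : ℕ) + T := by
    have : n ≤ j * T + T := by rw [← Nat.succ_mul]; exact hnj.le
    exact_mod_cast this
  have h₇ : (p : ℝ) * T ≤ n := by exact_mod_cast hn
  have h₈ : 4 * (T : ℝ) ≤ ε * n :=
    calc 4 * (T : ℝ) ≤ ε * p * T := mul_le_mul_of_nonneg_right hpε.le T.cast_nonneg
      _ = ε * (p * T) := mul_assoc _ _ _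
      _ ≤ ε * n := mul_le_mul_of_nonneg_left h₇ hε.le
  calc |S n - X * n|
      = |(S n - S (j * T)) + (S (j * T) - g i ω * (j * T : ℕ)) - (X - g i ω) * (j * T : ℕ)
          - X * (n - (j * T : ℕ))| := by congr 1; ring
    _ ≤ |S n - S (j * T)| + |S (j * T) - g i ω * (j * T : ℕ)| + |X - g i ω| * (j * T : ℕ)
          + |X| * (n - (j * T : ℕ)) := by
        refine (abs_sub _ _).trans (add_le_add ((abs_sub _ _).trans (add_le_add
          (abs_add_le _ _) ?_)) ?_)
        · rw [abs_mul, Nat.abs_cast]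
        · rw [abs_mul, abs_of_nonneg (sub_nonneg.2 h₅)]
    _ ≤ ε * n := by linarith [mul_le_mul_of_nonneg_left h₅ hε.le]

/-- The contraction exponents of the sponge with a dimension gap, by coordinate and tag. -/
def rate : ℕ → Fin 4 → ℕ
  | 0 => ![808, 808, 792, 792]
  | 1 => ![12672, 12928, 12928, 12672]
  | i + 2 => fun _ => 204800 * (i + 1)

/-- The entropy exponents of the sponge with a dimension gap, by coordinate and tag. -/
def height : ℕ → Fin 4 → ℕ
  | 0 => ![202, 0, 0, 198]
  | 1 => ![3168, 3232, 0, 0]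
  | 2 => ![0, 51200, 102400, 51200]
  | _ + 3 => 0

theorem height_lt_rate (i : ℕ) (j j' : Fin 4) : height i j < rate i j' := by
  match i with
  | 0 => revert j j'; decide
  | 1 => revert j j'; decide
  | 2 => revert j j'; decide
  | i + 3 => simp [height, rate]

theorem strictMono_rate (j : Fin 4) : StrictMono fun i => rate i j := by
  refine strictMono_nat_of_lt_succ fun i => ?_
  match i with
  | 0 => revert j; decide
  | 1 => revert j; decide
  | i + 2 => simp [rate]

theorem sum_rate_zero (s : ℕ → Fin 4) (n : ℕ) :
    ((∑ k ∈ Finset.range n, rate 0 (s k) : ℕ) : ℝ) =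
      8 * (100 * n + ∑ k ∈ Finset.range n, cornerX (s k)) := by
  have h (j : Fin 4) : (rate 0 j : ℝ) = 8 * (100 + cornerX j) := by
    fin_cases j <;> norm_num [rate, cornerX]
  simp only [Nat.cast_sum, h, ← Finset.mul_sum, Finset.sum_add_distrib, Finset.sum_const,
    Finset.card_range, nsmul_eq_mul]
  ring

theorem sum_rate_one (s : ℕ → Fin 4) (n : ℕ) :
    ((∑ k ∈ Finset.range n, rate 1 (s k) : ℕ) : ℝ) =
      8 * (16 * (100 * n + ∑ k ∈ Finset.range n, cornerY (s k))) := by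
  have h (j : Fin 4) : (rate 1 j : ℝ) = 128 * (100 + cornerY j) := by
    fin_cases j <;> norm_num [rate, cornerY]
  simp only [Nat.cast_sum, h, ← Finset.mul_sum, Finset.sum_add_distrib, Finset.sum_const,
    Finset.card_range, nsmul_eq_mul]
  ring

theorem sum_rate_add_two (s : ℕ → Fin 4) (i n : ℕ) :
    ∑ k ∈ Finset.range n, rate (i + 2) (s k) = 204800 * n * (i + 1) := by
  simp only [rate, Finset.sum_const, Finset.card_range, smul_eq_mul]
  ring

theorem sum_height {e : ℕ} (s : ℕ → Fin 4) (n : Fin (e + 3) → ℕ) :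
    ((∑ i, ∑ k ∈ Finset.range (n i), height i (s k) : ℕ) : ℝ) = dimSum s (n 0) (n 1) (n 2) := by
  have h₀ (j : Fin 4) :
      (height 0 j : ℝ) = 100 + cornerX j - 100 * cornerY j - cornerXY j := by
    fin_cases j <;> norm_num [height, cornerX, cornerY, cornerXY]
  have h₁ (j : Fin 4) :
      (height 1 j : ℝ) = 16 * (100 + cornerY j + 100 * cornerX j + cornerXY j) := by
    fin_cases j <;> norm_num [height, cornerX, cornerY, cornerXY]
  have h₂ (j : Fin 4) : (height 2 j : ℝ) = 25600 * (2 + cornerY j - cornerX j) := by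
    fin_cases j <;> norm_num [height, cornerX, cornerY]
  have h₃ (i : Fin e) (j : Fin 4) : height (i.succ.succ.succ : Fin (e + 3)) j = 0 := rfl
  rw [Fin.sum_univ_succ, Fin.sum_univ_succ, Fin.sum_univ_succ]
  simp only [h₃, Finset.sum_const_zero, add_zero]
  change ((∑ k ∈ Finset.range (n 0), height 0 (s k) + (∑ k ∈ Finset.range (n 1), height 1 (s k) +
    ∑ k ∈ Finset.range (n 2), height 2 (s k)) : ℕ) : ℝ) = _
  simp only [Nat.cast_add, Nat.cast_sum, h₀, h₁, h₂, ← Finset.mul_sum, Finset.sum_add_distrib,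
    Finset.sum_sub_distrib, Finset.sum_const, Finset.card_range, nsmul_eq_mul, dimSum]
  ring

theorem dynDim_sponge_le (e : ℕ) {N : ℕ} (hN : 8 ≤ N) :
    (sponge N (fun i : Fin (e + 3) => rate i) (fun i => height i)).dynDim ≤
      ENNReal.ofReal ((4 + 1 / 1000) / 8 + Real.log 4 / Real.log N) := by
  refine dynDim_le hN (fun i => height_lt_rate i) (C := 204800) (by norm_num) fun μ hμ hinv => ?_
  have hmeas : Measurable (shift : (ℕ → (sponge N (fun i : Fin (e + 3) => rate i)
      (fun i => height i)).Symb) → _) :=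
    measurable_pi_iff.2 fun k => measurable_pi_apply (k + 1)
  have hshift (k : ℕ) (ω : ℕ → (sponge N (fun i : Fin (e + 3) => rate i)
      (fun i => height i)).Symb) : shift^[k] ω 0 = ω k := by
    suffices h : ∀ n, shift^[k] ω n = ω (n + k) by simpa using h 0
    induction k with
    | zero => simp
    | succ k ih =>
      intro n
      rw [Function.iterate_succ_apply', shift, ih]
      congr 1
      omega
  set f : Fin 3 → Fin 4 → ℝ := ![cornerX, cornerY, cornerXY] with hf
  have hf₁ (i : Fin 3) (j : Fin 4) : |f i j| ≤ 1 := by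
    fin_cases i
    exacts [abs_cornerX_le j, abs_cornerY_le j, abs_cornerXY_le j]
  filter_upwards [ae_frequently_birkhoffSum_near (f := fun i ω => f i (state (ω 0)))
    ⟨hmeas, hinv⟩ (fun i => (measurable_of_countable fun a => f i (state a)).comp
      (measurable_pi_apply 0)) (fun i ω => hf₁ i _) (ε := 1 / 10 ^ 5) (by norm_num)
      (q := 512) (by norm_num)] with ω hω
  refine (hω.and_eventually (eventually_ge_atTop (10 ^ 8))).mono ?_
  rintro T ⟨h, hT⟩
  simp only [hshift] at h
  obtain ⟨X, hX, hsX⟩ := h 0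
  obtain ⟨Y, hY, hsY⟩ := h 1
  obtain ⟨Z, hZ, hsZ⟩ := h 2
  obtain ⟨n₁, hn₁, n₂, hn₂, h₁, h₂, hsum⟩ :=
    exists_dimSum_le (s := fun k => state (ω k)) hT hX hY hZ hsX hsY hsZ
  refine ⟨Fin.cons n₁ (Fin.cons n₂ fun _ => T), ?_, ?_, ?_⟩
  · refine Fin.cases ?_ (Fin.cases ?_ fun i => ?_)
    · exact hn₁.trans (Nat.mul_le_mul_right _ (by norm_num))
    · exact hn₂.trans (Nat.mul_le_mul_right _ (by norm_num))
    · exact Nat.le_mul_of_pos_left T (by norm_num)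
  · refine Fin.cases ?_ (Fin.cases ?_ fun i => ?_)
    · rw [← Nat.cast_le (α := ℝ)]
      refine le_of_le_of_eq ?_ (sum_rate_zero (fun k => state (ω k)) n₁).symm
      push_cast
      linarith
    · rw [← Nat.cast_le (α := ℝ)]
      refine le_of_le_of_eq ?_ (sum_rate_one (fun k => state (ω k)) n₂).symm
      push_cast
      linarith
    · refine le_of_le_of_eq ?_ (sum_rate_add_two (fun k => state (ω k)) i T).symm
      exact Nat.le_mul_of_pos_right _ (Nat.succ_pos _)
  · rw [sum_height (fun k => state (ω k))]
    refine hsum.trans ?_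
    push_cast
    linarith

theorem le_dimH_sponge (e : ℕ) {N : ℕ} (hN : 8 ≤ N) {t : ℝ≥0} (ht : (t : ℝ) < (4 + 3 / 1000) / 8) :
    (t : ℝ≥0∞) ≤ dimH (sponge N (fun i : Fin (e + 3) => rate i) (fun i => height i)).limitSet := by
  refine le_dimH_limitSet hN (fun i => height_lt_rate i) (C := 204800) (by norm_num) (s := spiral)
    ?_ ht
  filter_upwards [spiral_dimSum_ge] with T ⟨n₁, n₂, h₁, h₂, h⟩
  refine ⟨Fin.cons n₁ (Fin.cons n₂ (Fin.cons T fun _ => 0)), ?_, ?_⟩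
  · refine Fin.cases ?_ (Fin.cases ?_ (Fin.cases ?_ fun i => ?_))
    · rw [← Nat.cast_le (α := ℝ)]
      refine (sum_rate_zero spiral n₁).trans_le ?_
      push_cast
      linarith
    · rw [← Nat.cast_le (α := ℝ)]
      refine (sum_rate_one spiral n₂).trans_le ?_
      push_cast
      linarith
    · refine (sum_rate_add_two spiral 0 T).trans_le ?_
      omega
    · simp
  · rw [sum_height]
    refine le_trans ?_ h
    push_cast
    linarith

/-- **Existence of sponges with a dimension gap.** For every `d ≥ 3` there is a
strongly Barański diagonal IFS on `[0,1]^d` satisfying the coordinate ordering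
condition whose limit set has Hausdorff dimension strictly greater than its
dynamical dimension. -/
theorem exists_dimension_gap (d : ℕ) (hd : 3 ≤ d) :
    ∃ (N : Fin d → ℕ) (Φ : DiagIFS d fun i => Fin (N i)),
      Φ.Valid ∧ Φ.StronglyBaranski ∧ Φ.CoordOrdering ∧
        Φ.dynDim < dimH Φ.limitSet := by
  obtain ⟨e, rfl⟩ := Nat.exists_eq_add_of_le' hd
  obtain ⟨N, hN, hlog⟩ : ∃ N : ℕ, 8 ≤ N ∧ Real.log 4 / Real.log N = 1 / (10000 : ℕ) := by
    refine ⟨4 ^ 10000, (by norm_num : 8 ≤ 4 ^ 2).trans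
      (Nat.pow_le_pow_right (by norm_num) (by norm_num)), ?_⟩
    generalize 10000 = m
    rw [Nat.cast_pow, Real.log_pow, Nat.cast_ofNat,
      div_mul_cancel_right₀ (Real.log_pos (by norm_num)).ne', one_div]
  refine ⟨_, sponge N (fun i : Fin (e + 3) => rate i) (fun i => height i),
    sponge_valid hN fun i => height_lt_rate i, sponge_stronglyBaranski hN fun i => height_lt_rate i,
    sponge_coordOrdering hN fun j i i' hi => strictMono_rate j hi, ?_⟩
  refine (dynDim_sponge_le e hN).trans_lt
    (lt_of_lt_of_le ?_ (le_dimH_sponge e hN (t := 5003 / 10000) (by norm_num)))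
  rw [hlog, ENNReal.ofReal_lt_iff_lt_toReal (by norm_num) ENNReal.coe_ne_top]
  norm_num

end SelfAffineSponge
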